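/- Let M₁ and M₂ be countably compact normal n₁- and n₂-manifolds with dim M₁ = m₁ and dim M₂ = m₂, and let M_i* = βM_i \ M_i denote the Stone–Čech remainders. Then dim(M₁ × M₂) = max{ n₁ + m₂, n₂ + m₁, dim(M₁* × M₂*) }. -/

import Mathlib

open Set Topology

universe u v w

/-- An abstract simplicial complex on a vertex set `V`. -/
structure SimpComplex (V : Type v) where
  faces : Set (Finset V)
  down_closed : ∀ s ∈ faces, ∀ t, t ⊆ s → t.Nonempty → t ∈ faces

/-- The geometric realization of a simplicial complex with the metric (ℓ¹) topology,
realized inside the Banach space `ℓ¹(V)`. -/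
def SimpComplex.space {V : Type v} (K : SimpComplex V) : Set (lp (fun _ : V => ℝ) 1) :=
  {f | ∃ s ∈ K.faces, (∀ v : V, (f : ∀ _ : V, ℝ) v ≠ 0 → v ∈ s) ∧
    (∀ v : V, 0 ≤ (f : ∀ _ : V, ℝ) v) ∧ ∑ v ∈ s, (f : ∀ _ : V, ℝ) v = 1}

/-- `Z` is an absolute extensor of `X`: every continuous map from a closed subset of `X`
into `Z` extends continuously over all of `X`. -/
def IsAE (Z X : Type*) [TopologicalSpace Z] [TopologicalSpace X] : Prop :=
  ∀ Y : Set X, IsClosed Y → ∀ f : C(Y, Z), ∃ g : C(X, Z), ∀ y : Y, g y = f y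

/-- `Z` is an absolute neighborhood extensor of `X`. -/
def IsANE (Z X : Type*) [TopologicalSpace Z] [TopologicalSpace X] : Prop :=
  ∀ Y : Set X, IsClosed Y → ∀ f : C(Y, Z),
    ∃ U : Set X, IsOpen U ∧ Y ⊆ U ∧ ∃ g : C(U, Z),
      ∀ (y : Y) (h : (y : X) ∈ U), g ⟨y, h⟩ = f y

/-- A space is countably compact if every countable open cover has a finite subcover. -/
def CountablyCompact (X : Type*) [TopologicalSpace X] : Prop :=
  ∀ 𝒰 : ℕ → Set X, (∀ n, IsOpen (𝒰 n)) → (⋃ n, 𝒰 n) = univ →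
    ∃ t : Finset ℕ, (⋃ n ∈ t, 𝒰 n) = univ

/-- A set is functionally open if it is the cozero set of a real-valued continuous function. -/
def FunctionallyOpen {X : Type*} [TopologicalSpace X] (U : Set X) : Prop :=
  ∃ φ : C(X, ℝ), U = φ ⁻¹' ({0}ᶜ)

/-- `CovDimLE X n` : every finite functionally open cover of `X` has a finite functionally
open refinement of order at most `n + 1` (any `n + 2` distinct members meet emptily). -/
def CovDimLE (X : Type*) [TopologicalSpace X] (n : ℕ) : Prop :=
  ∀ 𝒰 : Finset (Set X), (∀ U ∈ 𝒰, FunctionallyOpen U) → ⋃₀ (𝒰 : Set (Set X)) = univ →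
    ∃ 𝒱 : Finset (Set X), (∀ V ∈ 𝒱, FunctionallyOpen V) ∧ ⋃₀ (𝒱 : Set (Set X)) = univ ∧
      (∀ V ∈ 𝒱, ∃ U ∈ 𝒰, V ⊆ U) ∧
      ∀ 𝒲 : Finset (Set X), 𝒲 ⊆ 𝒱 → n + 1 < 𝒲.card → ⋂₀ (𝒲 : Set (Set X)) = ∅

/-- The covering dimension of `X` as an extended natural number (`⊤` if no finite bound). -/
noncomputable def covDim (X : Type*) [TopologicalSpace X] : ℕ∞ :=
  sInf ((↑) '' {n : ℕ | CovDimLE X n})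

/-- The Stone–Čech remainder `βX \ X`. -/
def StoneCechRemainder (X : Type*) [TopologicalSpace X] : Set (StoneCech X) :=
  (range (stoneCechUnit : X → StoneCech X))ᶜ

/-- `M` is an `n`-manifold: every point has an open neighborhood homeomorphic to `ℝⁿ`. -/
def IsTopManifold (M : Type*) [TopologicalSpace M] (n : ℕ) : Prop :=
  ∀ x : M, ∃ U : Set M, IsOpen U ∧ x ∈ U ∧ Nonempty (↥U ≃ₜ EuclideanSpace ℝ (Fin n))




section RemBasics

set_option linter.unusedSectionVars false

/-- Every map `X → E` can be made nonvanishing without changing it where `‖g‖ ≥ 1`. -/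
def Rem (X : Type*) [TopologicalSpace X] (E : Type*) [NormedAddCommGroup E] : Prop :=
  ∀ g : C(X, E), ∃ g' : C(X, E), (∀ x, g' x ≠ 0) ∧ ∀ x, 1 ≤ ‖g x‖ → g' x = g x

/-- As `Rem`, but nonvanishing only on the set `S`. -/
def RemOn {X : Type*} [TopologicalSpace X] (S : Set X) (E : Type*) [NormedAddCommGroup E] : Prop :=
  ∀ g : C(X, E), ∃ g' : C(X, E), (∀ x ∈ S, g' x ≠ 0) ∧ ∀ x, 1 ≤ ‖g x‖ → g' x = g x

/-- A cut-off function: equal to one below `a` and to zero above `b`. -/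
noncomputable def cutoff (a b t : ℝ) : ℝ := max 0 (min 1 ((b - t) / (b - a)))

lemma cutoff_cont (a b : ℝ) : Continuous (cutoff a b) := by
  unfold cutoff; fun_prop

lemma cutoff_one {a b t : ℝ} (hab : a < b) (h : t ≤ a) : cutoff a b t = 1 := by
  unfold cutoff
  have : 1 ≤ (b - t) / (b - a) := by
    rw [le_div_iff₀ (by linarith)]; linarith
  rw [min_eq_left this]; simp

lemma cutoff_zero {a b t : ℝ} (hab : a < b) (h : b ≤ t) : cutoff a b t = 0 := by
  unfold cutoff
  have : (b - t) / (b - a) ≤ 0 := div_nonpos_of_nonpos_of_nonneg (by linarith) (by linarith)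
  rw [max_eq_left]
  exact (min_le_right _ _).trans this

lemma cutoff_nonneg (a b t : ℝ) : 0 ≤ cutoff a b t := le_max_left _ _

lemma cutoff_le_one (a b t : ℝ) : cutoff a b t ≤ 1 := max_le zero_le_one (min_le_left _ _)

variable {X : Type*} [TopologicalSpace X] {E : Type*} [NormedAddCommGroup E] [NormedSpace ℝ E]

lemma RemOn.scale {S : Set X} (h : RemOn S E) {r : ℝ} (hr : 0 < r) (g : C(X, E)) :
    ∃ g' : C(X, E), (∀ x ∈ S, g' x ≠ 0) ∧ ∀ x, r ≤ ‖g x‖ → g' x = g x := by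
  obtain ⟨g', h1, h2⟩ := h (r⁻¹ • g)
  refine ⟨r • g', fun x hx => ?_, fun x hx => ?_⟩
  · simpa [hr.ne'] using h1 x hx
  · have := h2 x (by
      simp only [ContinuousMap.coe_smul, Pi.smul_apply, norm_smul, norm_inv, Real.norm_eq_abs, abs_of_pos hr]
      rw [inv_mul_eq_div, le_div_iff₀ hr]; linarith)
    simp [this, smul_smul, hr.ne']

lemma remOn_univ : RemOn (univ : Set X) E ↔ Rem X E := by simp [RemOn, Rem]

lemma Rem.scale (h : Rem X E) {r : ℝ} (hr : 0 < r) (g : C(X, E)) :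
    ∃ g' : C(X, E), (∀ x, g' x ≠ 0) ∧ ∀ x, r ≤ ‖g x‖ → g' x = g x := by
  simpa using (remOn_univ.2 h).scale hr g

lemma Rem.of_scale {r : ℝ} (hr : 0 < r) (h : ∀ g : C(X, E),
    ∃ g' : C(X, E), (∀ x, g' x ≠ 0) ∧ ∀ x, r ≤ ‖g x‖ → g' x = g x) : Rem X E := by
  intro g
  obtain ⟨g', h1, h2⟩ := h (r • g)
  refine ⟨r⁻¹ • g', fun x => ?_, fun x hx => ?_⟩
  · simpa [hr.ne'] using h1 x
  · have := h2 x (by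
      simp only [ContinuousMap.coe_smul, Pi.smul_apply, norm_smul, Real.norm_eq_abs, abs_of_pos hr]
      nlinarith)
    simp [this, smul_smul, hr.ne']

lemma RemOn.mono {S T : Set X} (h : RemOn T E) (hST : S ⊆ T) : RemOn S E := fun g => by
  obtain ⟨g', h1, h2⟩ := h g
  exact ⟨g', fun x hx => h1 x (hST hx), h2⟩

lemma gap_of_compact {S : Set X} (hS : IsCompact S) (g : C(X, E)) (h : ∀ x ∈ S, g x ≠ 0) :
    ∃ η : ℝ, 0 < η ∧ η ≤ 1 ∧ ∀ x ∈ S, η ≤ ‖g x‖ := by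
  rcases S.eq_empty_or_nonempty with rfl | hne
  · exact ⟨1, one_pos, le_rfl, by simp⟩
  · obtain ⟨x, hx, hm⟩ := hS.exists_isMinOn hne (f := fun x => ‖g x‖) (by fun_prop)
    refine ⟨min 1 ‖g x‖, lt_min one_pos (norm_pos_iff.2 (h x hx)), min_le_left _ _, fun y hy => ?_⟩
    exact (min_le_right _ _).trans (hm hy)

lemma RemOn.union {S T : Set X} (hSc : IsCompact S) (hS : RemOn S E) (hT : RemOn T E) :
    RemOn (S ∪ T) E := by
  intro g
  obtain ⟨g1, h1, h2⟩ := hS g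
  obtain ⟨η, hη, hη1, hg⟩ := gap_of_compact hSc g1 h1
  obtain ⟨g2, h3, h4⟩ := hT.scale hη g1
  refine ⟨g2, ?_, fun x hx => ?_⟩
  · rintro x (hx | hx)
    · rw [h4 x (hg x hx)]; exact h1 x hx
    · exact h3 x hx
  · rw [h4 x (by rw [h2 x hx]; linarith), h2 x hx]

lemma RemOn.empty : RemOn (∅ : Set X) E := fun g => ⟨g, by simp, fun _ _ => rfl⟩

lemma RemOn.biUnion {ι : Type*} (s : Finset ι) (C : ι → Set X) (hc : ∀ i ∈ s, IsCompact (C i))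
    (h : ∀ i ∈ s, RemOn (C i) E) : RemOn (⋃ i ∈ s, C i) E := by
  classical
  induction s using Finset.induction_on with
  | empty => simpa using RemOn.empty
  | insert a s ha ih =>
    rw [Finset.set_biUnion_insert]
    exact RemOn.union (hc a (by simp)) (h a (by simp))
      (ih (fun i hi => hc i (by simp [hi])) (fun i hi => h i (by simp [hi])))

/-- Dowker's theorem. -/
lemma rem_of_dowker [CompactSpace X] {F : Set X} (hF : IsClosed F) (h : RemOn F E)
    (hY : ∀ Y : Set X, IsClosed Y → Disjoint Y F → RemOn Y E) : Rem X E := by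
  intro g
  obtain ⟨g1, h1, h2⟩ := h g
  obtain ⟨η, hη, hη1, hg⟩ := gap_of_compact hF.isCompact g1 h1
  have hcl : IsClosed {x | ‖g1 x‖ ≤ η / 2} := isClosed_le (by fun_prop) (by fun_prop)
  have := hY _ hcl (by
    rw [Set.disjoint_left]
    intro x hx hxF
    have := hg x hxF
    simp only [Set.mem_ofPred_eq] at hx
    linarith)
  obtain ⟨g2, h3, h4⟩ := this.scale (half_pos hη) g1
  refine ⟨g2, fun x => ?_, fun x hx => ?_⟩
  · by_cases hx : ‖g1 x‖ ≤ η / 2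
    · exact h3 x hx
    · push Not at hx
      rw [h4 x hx.le]
      intro h0
      rw [h0] at hx
      simp at hx
      linarith
  · rw [h4 x (by rw [h2 x hx]; linarith), h2 x hx]

/-- Change of the target by a linear equivalence. -/
lemma Rem.congr {E' : Type*} [NormedAddCommGroup E'] [NormedSpace ℝ E'] (e : E ≃L[ℝ] E')
    (h : Rem X E) : Rem X E' := by
  intro g
  have hpos : 0 < (‖(e : E →L[ℝ] E')‖ + 1)⁻¹ := by positivity
  obtain ⟨g', h1, h2⟩ := h.scale hpos ⟨fun x => e.symm (g x), by fun_prop⟩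
  refine ⟨⟨fun x => e (g' x), by fun_prop⟩, fun x => by simpa using h1 x, fun x hx => ?_⟩
  have := h2 x (by
    simp only [ContinuousMap.coe_mk]
    have h3 : ‖g x‖ ≤ ‖(e : E →L[ℝ] E')‖ * ‖e.symm (g x)‖ := by
      simpa using (e : E →L[ℝ] E').le_opNorm (e.symm (g x))
    rw [inv_le_iff_one_le_mul₀ (by positivity)]
    have := norm_nonneg (e.symm (g x))
    nlinarith)
  simp [this]

lemma Rem.congr_finrank {E' : Type*} [NormedAddCommGroup E'] [NormedSpace ℝ E']
    [FiniteDimensional ℝ E] [FiniteDimensional ℝ E']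
    (e : Module.finrank ℝ E = Module.finrank ℝ E')
    (h : Rem X E) : Rem X E' := h.congr (ContinuousLinearEquiv.ofFinrankEq e)

/-- Closed embeddings into normal spaces: restriction. -/
lemma Rem.of_isClosedEmbedding {Y : Type*} [TopologicalSpace Y] [NormalSpace X]
    {k : ℕ} {j : Y → X} (hj : IsClosedEmbedding j) (h : Rem X (Fin k → ℝ)) :
    Rem Y (Fin k → ℝ) := by
  intro g
  obtain ⟨G, hG⟩ := g.exists_extension hj
  have hG' : ∀ y, G (j y) = g y := fun y => DFunLike.congr_fun hG y
  obtain ⟨G', h1, h2⟩ := h G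
  refine ⟨⟨fun y => G' (j y), G'.continuous.comp hj.continuous⟩, fun y => h1 _, fun y hy => ?_⟩
  simp only [ContinuousMap.coe_mk]
  rw [h2 _ (by rwa [hG']), hG']

lemma Rem.of_homeo {Y : Type*} [TopologicalSpace Y] (e : X ≃ₜ Y) (h : Rem X E) : Rem Y E := by
  intro g
  obtain ⟨g', h1, h2⟩ := h (g.comp ⟨e, e.continuous⟩)
  refine ⟨g'.comp ⟨e.symm, e.symm.continuous⟩, fun y => h1 _, fun y hy => ?_⟩
  have := h2 (e.symm y) (by simpa using hy)
  simpa using this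

/-- `RemOn` on the range of a closed embedding. -/
lemma remOn_range {Y : Type*} [TopologicalSpace Y] [NormalSpace X]
    {k : ℕ} {j : Y → X} (hj : IsClosedEmbedding j) (h : Rem Y (Fin k → ℝ)) :
    RemOn (range j) (Fin k → ℝ) := by
  intro g
  obtain ⟨g1, h1, h2⟩ := h.scale (r := 1/2) (by norm_num) (g.comp ⟨j, hj.continuous⟩)
  obtain ⟨G, hG⟩ := g1.exists_extension hj
  have hG' : ∀ y, G (j y) = g1 y := fun y => DFunLike.congr_fun hG y
  refine ⟨⟨fun x => g x + cutoff (1/2) 1 ‖g x‖ • (G x - g x), ?_⟩, ?_, fun x hx => ?_⟩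
  · have := cutoff_cont (1/2) 1
    fun_prop
  · rintro _ ⟨y, rfl⟩
    simp only [ContinuousMap.coe_mk]
    rcases le_total ‖g (j y)‖ (1/2) with hy | hy
    · rw [cutoff_one (by norm_num) hy, hG']
      simpa using h1 y
    · have : g1 y = g (j y) := h2 y hy
      rw [hG', this]
      simpa [← this] using h1 y
  · simp only [ContinuousMap.coe_mk]
    rw [cutoff_zero (by norm_num) hx]; simp

/-- Approximation suffices. -/
lemma rem_of_approx (h : ∀ g : C(X, E), ∃ g' : C(X, E), (∀ x, g' x ≠ 0) ∧
    ∀ x, 1 ≤ ‖g x‖ → ‖g x‖ ≤ 2 → ‖g' x - g x‖ < 1) : Rem X E := by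
  refine Rem.of_scale (r := 2) two_pos fun g => ?_
  obtain ⟨G, h1, h2⟩ := h g
  refine ⟨⟨fun x => g x + cutoff 1 2 ‖g x‖ • (G x - g x), ?_⟩, fun x => ?_, fun x hx => ?_⟩
  · have := cutoff_cont 1 2
    fun_prop
  · simp only [ContinuousMap.coe_mk]
    rcases le_total ‖g x‖ 1 with hy | hy
    · rw [cutoff_one (by norm_num) hy]
      simpa using h1 x
    rcases le_total ‖g x‖ 2 with hy' | hy'
    · intro h0
      have h3 : ‖g x‖ = ‖cutoff 1 2 ‖g x‖ • (G x - g x)‖ := by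
        have := congrArg norm (eq_neg_of_add_eq_zero_left h0)
        rwa [norm_neg] at this
      rw [norm_smul, Real.norm_eq_abs, abs_of_nonneg (cutoff_nonneg _ _ _)] at h3
      have h4 := h2 x hy hy'
      have h5 := cutoff_le_one 1 2 ‖g x‖
      have := norm_nonneg (G x - g x)
      have := cutoff_nonneg 1 2 ‖g x‖
      nlinarith
    · rw [cutoff_zero (by norm_num) hy']
      simp only [zero_smul, add_zero]
      intro h0
      rw [h0] at hy'; simp at hy'; linarith
  · simp only [ContinuousMap.coe_mk]
    rw [cutoff_zero (by norm_num) hx]; simp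

/-- Invariance under `C*`-embedded dense maps. -/
lemma rem_iff_of_extends {Y : Type*} [TopologicalSpace Y] {k : ℕ} (i : C(X, Y)) (hd : DenseRange i)
    (hext : ∀ f : C(X, ℝ), (∀ x, |f x| ≤ 1) → ∃ F : C(Y, ℝ), ∀ x, F (i x) = f x) :
    Rem X (Fin k → ℝ) ↔ Rem Y (Fin k → ℝ) := by
  have hextE : ∀ f : C(X, Fin k → ℝ), (∀ x, ‖f x‖ ≤ 1) →
      ∃ F : C(Y, Fin k → ℝ), ∀ x, F (i x) = f x := by
    intro f hf
    have : ∀ l, ∃ F : C(Y, ℝ), ∀ x, F (i x) = f x l := fun l => by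
      obtain ⟨F, hF⟩ := hext ⟨fun x => f x l, by fun_prop⟩
        (fun x => (norm_le_pi_norm (f x) l).trans (hf x))
      exact ⟨F, hF⟩
    choose F hF using this
    exact ⟨⟨fun y l => F l y, by fun_prop⟩, fun x => funext fun l => hF l x⟩
  constructor
  · intro h G
    obtain ⟨g', h1, h2⟩ := h.scale (r := 1/2) (by norm_num) (G.comp i)
    obtain ⟨U, hU⟩ := hextE ⟨fun x => ‖g' x‖⁻¹ • g' x, by
      refine Continuous.smul (Continuous.inv₀ (by fun_prop) fun x => norm_ne_zero_iff.2 (h1 x))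
        (by fun_prop)⟩ (fun x => by
        simp [norm_smul, norm_ne_zero_iff.2 (h1 x)])
    have hU1 : ∀ y, ‖U y‖ = 1 := by
      intro y
      refine hd.induction_on (p := fun y => ‖U y‖ = 1) y (isClosed_eq (by fun_prop) (by fun_prop)) fun x => ?_
      rw [hU]
      simp [norm_smul, norm_ne_zero_iff.2 (h1 x)]
    have hU2 : ∀ y, ‖G y‖ ≤ 1/2 ∨ ‖G y‖ • U y = G y := by
      intro y
      refine hd.induction_on (p := fun y => ‖G y‖ ≤ 1/2 ∨ ‖G y‖ • U y = G y) y
        (by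
          have h1 : IsClosed {y | ‖G y‖ ≤ 1/2} := isClosed_le (by fun_prop) (by fun_prop)
          have h2 : IsClosed {y | ‖G y‖ • U y = G y} := isClosed_eq (by fun_prop) (by fun_prop)
          exact h1.union h2) fun x => ?_
      rcases le_total ‖G (i x)‖ (1/2) with h | h
      · exact Or.inl h
      · right
        have h3 : g' x = G (i x) := h2 x h
        rw [hU, ← h3]
        simp [smul_smul, norm_ne_zero_iff.2 (h1 x)]
    refine ⟨⟨fun y => max (1/2) ‖G y‖ • U y, by fun_prop⟩, fun y => ?_, fun y hy => ?_⟩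
    · simp only [ContinuousMap.coe_mk]
      refine smul_ne_zero (by positivity) ?_
      rw [← norm_ne_zero_iff, hU1]; norm_num
    · simp only [ContinuousMap.coe_mk]
      rw [max_eq_right (by linarith)]
      rcases hU2 y with h | h
      · linarith
      · exact h
  · intro h g
    have hpos : ∀ x, 0 < max 1 ‖g x‖ := fun x => by positivity
    obtain ⟨G, hG⟩ := hextE ⟨fun x => (max 1 ‖g x‖)⁻¹ • g x, by
      refine Continuous.smul (Continuous.inv₀ (by fun_prop) fun x => (hpos x).ne') (by fun_prop)⟩
      (fun x => by
        simp only [ContinuousMap.coe_mk, norm_smul, norm_inv, Real.norm_eq_abs, abs_of_pos (hpos x)]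
        rw [inv_mul_le_iff₀ (hpos x)]; simp)
    obtain ⟨G', h1, h2⟩ := h G
    refine ⟨⟨fun x => max 1 ‖g x‖ • G' (i x), by fun_prop⟩,
      fun x => smul_ne_zero (hpos x).ne' (h1 _), fun x hx => ?_⟩
    have hx' : max 1 ‖g x‖ = ‖g x‖ := max_eq_right hx
    have h3 : G (i x) = ‖g x‖⁻¹ • g x := by rw [hG]; simp [hx']
    have h4 : ‖g x‖ ≠ 0 := by linarith
    simp only [ContinuousMap.coe_mk]
    rw [h2 _ (by rw [h3]; simp [norm_smul, h4]), h3, hx', smul_smul, mul_inv_cancel₀ h4, one_smul]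

end RemBasics



section Generic

lemma finite_bad {κ : Type*} [Finite κ] {E : Type*} [AddCommGroup E] [Module ℝ E]
    (w w' : κ → E) (h : LinearIndependent ℝ w') :
    {s : ℝ | ¬ LinearIndependent ℝ (w + s • w')}.Finite := by
  classical
  cases nonempty_fintype κ
  obtain ⟨P, hP⟩ := LinearMap.exists_leftInverse_of_injective
    (Fintype.linearCombination ℝ w') (LinearMap.ker_eq_bot.2 (by
      exact h.fintypeLinearCombination_injective))
  have hP' : ∀ i, P (w' i) = Pi.single i 1 := fun i => by
    have := LinearMap.congr_fun hP (Pi.single i 1)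
    simpa [Fintype.linearCombination_apply, Pi.single_apply, ite_smul] using this
  let A : Matrix κ κ ℝ := Matrix.of fun i => P (w i)
  refine Set.Finite.subset ((-A).charpoly.roots.toFinset.finite_toSet) fun s hs => ?_
  simp only [Finset.mem_coe, Multiset.mem_toFinset]
  rw [Polynomial.mem_roots (Matrix.charpoly_monic _).ne_zero, Polynomial.IsRoot.def,
    Matrix.eval_charpoly]
  by_contra hne
  refine hs (LinearIndependent.of_comp P ?_)
  have : P ∘ (w + s • w') = (Matrix.scalar κ s - -A).row := by
    ext i j
    simp [hP', A, Matrix.row, Matrix.scalar_apply, Matrix.diagonal_apply, Pi.single_apply, add_comm, eq_comm]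
  rw [this]
  exact Matrix.linearIndependent_rows_of_det_ne_zero hne

lemma generic {Y : Type*} [NormedAddCommGroup Y] [NormedSpace ℝ Y] [FiniteDimensional ℝ Y]
    {E : Type*} [NormedAddCommGroup E] [NormedSpace ℝ E] [FiniteDimensional ℝ E]
    {C : Type*} [Finite C] {κ : C → Type*} [∀ c, Finite (κ c)]
    (Λ : ∀ c, Y →ₗ[ℝ] (κ c → E)) (hw : ∀ c, ∃ y, LinearIndependent ℝ (Λ c y))
    (y₀ : Y) {r : ℝ} (hr : 0 < r) :
    ∃ y, dist y y₀ < r ∧ ∀ c, LinearIndependent ℝ (Λ c y) := by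
  classical
  have hden : Dense (⋂ c, {y | LinearIndependent ℝ (Λ c y)}) := by
    refine dense_iInter_of_isOpen (fun c => ?_) (fun c => ?_)
    · have hc : Continuous (Λ c) := by
        cases nonempty_fintype (κ c)
        exact LinearMap.continuous_of_finiteDimensional _
      exact isOpen_setOfPred_linearIndependent.preimage hc
    · obtain ⟨y', hy'⟩ := hw c
      rw [Metric.dense_iff]
      intro y ρ hρ
      have hfin := finite_bad (Λ c y) (Λ c y') hy'
      have : (Ioo 0 (ρ / (‖y'‖ + 1))).Infinite := Ioo_infinite (by positivity)
      obtain ⟨s, hs, hs'⟩ := (this.sdiff hfin).nonempty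
      refine ⟨y + s • y', ?_, ?_⟩
      · have : s * (‖y'‖ + 1) < ρ := (lt_div_iff₀ (by positivity)).1 hs.2
        simp [norm_smul, abs_of_pos hs.1]
        nlinarith [hs.1]
      · have : LinearIndependent ℝ (Λ c y + s • Λ c y') := by
          by_contra h; exact hs' h
        simpa using this
  obtain ⟨y, hy, hy'⟩ := Metric.dense_iff.1 hden y₀ r hr
  exact ⟨y, hy, fun c => mem_iInter.1 hy' c⟩

end Generic



section Cover

lemma cover_lemma {X : Type*} [TopologicalSpace X] {n : ℕ} (h : CovDimLE X n) {F : Type*}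
    [PseudoMetricSpace F] (g : C(X, F)) (htb : TotallyBounded (range g)) {r : ℝ} (hr : 0 < r) :
    ∃ (R : ℕ) (y : Fin R → F) (φ : Fin R → C(X, ℝ)), (∀ i x, 0 ≤ φ i x) ∧
      (∀ x, ∑ i, φ i x = 1) ∧ (∀ i x, φ i x ≠ 0 → dist (g x) (y i) < r) ∧
      ∀ x (σ : Finset (Fin R)), (∀ i ∈ σ, φ i x ≠ 0) → σ.card ≤ n + 1 := by
  classical
  obtain ⟨t, ht, hcov⟩ := Metric.totallyBounded_iff.1 htb r hr
  obtain ⟨𝒱, hV1, hV2, hV3, hV4⟩ := h (ht.toFinset.image fun y => g ⁻¹' Metric.ball y r) (by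
    intro U hU
    obtain ⟨y, -, rfl⟩ := Finset.mem_image.1 hU
    refine ⟨⟨fun x => max 0 (r - dist (g x) y), by fun_prop⟩, ?_⟩
    ext x
    simp [Metric.mem_ball]) (by
    refine eq_univ_of_forall fun x => ?_
    have := hcov (mem_range_self x)
    simp only [mem_iUnion] at this
    obtain ⟨y, hy, hxy⟩ := this
    refine ⟨g ⁻¹' Metric.ball y r, ?_, hxy⟩
    simp only [Finset.coe_image, mem_image, Finset.mem_coe, Set.Finite.mem_toFinset]
    exact ⟨y, hy, rfl⟩)
  have e : Fin (Fintype.card 𝒱) ≃ 𝒱 := (Fintype.equivFin 𝒱).symm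
  have hV5 : ∀ V : 𝒱, ∃ f : C(X, ℝ), (V : Set X) = f ⁻¹' {0}ᶜ := fun V => hV1 V V.2
  choose f hf using hV5
  have hf' : ∀ (V : 𝒱) x, x ∈ (V : Set X) ↔ f V x ≠ 0 := fun V x => by
    conv_lhs => rw [hf V]
    simp
  have hV6 : ∀ V : 𝒱, ∃ y, ∀ x, x ∈ (V : Set X) → dist (g x) y < r := fun V => by
    obtain ⟨U, hU, hVU⟩ := hV3 V V.2
    obtain ⟨y, -, rfl⟩ := Finset.mem_image.1 hU
    exact ⟨y, fun x hx => hVU hx⟩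
  choose y hy using hV6
  have hpos : ∀ x, 0 < ∑ V : 𝒱, |f V x| := fun x => by
    have : x ∈ ⋃₀ (𝒱 : Set (Set X)) := by rw [hV2]; trivial
    obtain ⟨V, hV, hx⟩ := this
    refine Finset.sum_pos' (fun _ _ => abs_nonneg _) ⟨⟨V, hV⟩, Finset.mem_univ _, ?_⟩
    rw [abs_pos]
    exact (hf' ⟨V, hV⟩ x).1 hx
  refine ⟨Fintype.card 𝒱, y ∘ e, fun i => ⟨fun x => |f (e i) x| / ∑ V : 𝒱, |f V x|, ?_⟩,
    fun i x => ?_, fun x => ?_, fun i x hi => ?_, fun x σ hσ => ?_⟩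
  · exact Continuous.div (by fun_prop) (by fun_prop) fun x => (hpos x).ne'
  · exact div_nonneg (abs_nonneg _) (hpos x).le
  · simp only [ContinuousMap.coe_mk]
    rw [← Finset.sum_div, e.sum_comp (fun V => |f V x|), div_self (hpos x).ne']
  · refine hy (e i) x ((hf' _ x).2 ?_)
    intro h0
    simp [h0] at hi
  · by_contra hc
    push Not at hc
    have h1 := hV4 (σ.image fun i => (e i : Set X)) (by
      intro V hV
      obtain ⟨i, -, rfl⟩ := Finset.mem_image.1 hV
      exact (e i).2) (by
      rwa [Finset.card_image_of_injective]
      exact Subtype.val_injective.comp e.injective)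
    have h2 : x ∈ ⋂₀ ((σ.image fun i => (e i : Set X) : Finset (Set X)) : Set (Set X)) := by
      rintro V hV
      obtain ⟨i, hi, rfl⟩ := Finset.mem_image.1 hV
      refine (hf' _ x).2 ?_
      intro h0
      exact hσ i hi (by simp [h0])
    rw [h1] at h2
    exact h2

/-- Convex combinations of nearby points are nearby. -/
lemma dist_sum_lt {E : Type*} [NormedAddCommGroup E] [NormedSpace ℝ E] {R : ℕ}
    (φ : Fin R → ℝ) (h0 : ∀ i, 0 ≤ φ i) (h1 : ∑ i, φ i = 1) (y : Fin R → E) (a : E) {r : ℝ}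
    (h : ∀ i, φ i ≠ 0 → ‖y i - a‖ < r) : ‖∑ i, φ i • y i - a‖ < r := by
  have : ∑ i, φ i • y i - a = ∑ i, φ i • (y i - a) := by
    simp only [smul_sub, Finset.sum_sub_distrib, ← Finset.sum_smul, h1, one_smul]
  rw [this]
  refine (norm_sum_le _ _).trans_lt ?_
  have hex : ∃ i, φ i ≠ 0 := by
    by_contra hc
    push Not at hc
    simp [hc] at h1
  obtain ⟨i, hi⟩ := hex
  calc ∑ i, ‖φ i • (y i - a)‖ < ∑ i, φ i * r := by
        refine Finset.sum_lt_sum (fun j _ => ?_) ⟨i, Finset.mem_univ _, ?_⟩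
        · rw [norm_smul, Real.norm_eq_abs, abs_of_nonneg (h0 j)]
          by_cases hj : φ j = 0
          · simp [hj]
          · exact mul_le_mul_of_nonneg_left (h j hj).le (h0 j)
        · rw [norm_smul, Real.norm_eq_abs, abs_of_nonneg (h0 i)]
          exact mul_lt_mul_of_pos_left (h i hi) (lt_of_le_of_ne (h0 i) (Ne.symm hi))
    _ = r := by rw [← Finset.sum_mul, h1, one_mul]

lemma rem_of_covDimLE {X : Type*} [TopologicalSpace X] {n : ℕ} (h : CovDimLE X n) :
    Rem X (Fin (n + 1) → ℝ) := by
  classical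
  refine rem_of_approx fun g => ?_
  have hpos : ∀ x, 0 < max 1 (‖g x‖ / 2) := fun x => by positivity
  let g1 : C(X, Fin (n + 1) → ℝ) := ⟨fun x => (max 1 (‖g x‖ / 2))⁻¹ • g x,
    Continuous.smul (Continuous.inv₀ (by fun_prop) fun x => (hpos x).ne') (by fun_prop)⟩
  have hg1 : ∀ x, ‖g1 x‖ ≤ 2 := fun x => by
    simp only [g1, ContinuousMap.coe_mk, norm_smul, norm_inv, Real.norm_eq_abs, abs_of_pos (hpos x)]
    rw [inv_mul_le_iff₀ (hpos x)]
    have := le_max_right 1 (‖g x‖ / 2)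
    linarith
  have hg1' : ∀ x, ‖g x‖ ≤ 2 → g1 x = g x := fun x hx => by
    simp only [g1, ContinuousMap.coe_mk]
    rw [max_eq_left (by linarith)]; simp
  obtain ⟨R, y, φ, h0, h1, h2, h3⟩ := cover_lemma h g1 (by
    refine (isCompact_closedBall (0 : Fin (n + 1) → ℝ) 2).totallyBounded.subset ?_
    rintro _ ⟨x, rfl⟩
    simpa using hg1 x) (r := 1/2) (by norm_num)
  obtain ⟨y', hy', hind⟩ := generic (Y := Fin R → Fin (n + 1) → ℝ) (E := Fin (n + 1) → ℝ)
    (C := {σ : Finset (Fin R) // σ.card ≤ n + 1}) (κ := fun σ => σ.1)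
    (fun σ => LinearMap.funLeft ℝ _ (fun i : σ.1 => (i : Fin R))) (by
      rintro ⟨σ, hσ⟩
      have : ∃ f : σ → Fin (n + 1), Function.Injective f := by
        have : Fintype.card σ ≤ Fintype.card (Fin (n + 1)) := by simpa using hσ
        exact ⟨_, (Function.Embedding.nonempty_of_card_le this).some.injective⟩
      obtain ⟨f, hf⟩ := this
      refine ⟨fun i => if hi : i ∈ σ then Pi.single (f ⟨i, hi⟩) 1 else 0, ?_⟩
      have := (Pi.basisFun ℝ (Fin (n + 1))).linearIndependent.comp f hf
      convert this using 1
      · ext i j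
        simp [LinearMap.funLeft]
      · rfl
      · rfl) y (r := 1/2) (by norm_num)
  refine ⟨⟨fun x => ∑ i, φ i x • y' i, by fun_prop⟩, fun x hx => ?_, fun x hx hx' => ?_⟩
  · simp only [ContinuousMap.coe_mk] at hx
    let σ : Finset (Fin R) := Finset.univ.filter fun i => φ i x ≠ 0
    have hσ : σ.card ≤ n + 1 := h3 x σ (by simp [σ])
    have hl := hind ⟨σ, hσ⟩
    rw [Fintype.linearIndependent_iff] at hl
    have h4 := hl (fun i => φ i x) (by
      rw [← hx]
      simp only [LinearMap.funLeft_apply]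
      rw [Finset.sum_coe_sort σ (fun i => φ i x • y' i)]
      refine Finset.sum_subset (Finset.subset_univ _) fun i _ hi => ?_
      simp only [σ, Finset.mem_filter, Finset.mem_univ, true_and, not_not] at hi
      simp [hi])
    have h5 : ∀ i, φ i x = 0 := fun i => by
      by_contra hi
      exact hi (h4 ⟨i, by simpa [σ] using hi⟩)
    have := h1 x
    simp [h5] at this
  · refine dist_sum_lt (fun i => φ i x) (fun i => h0 i x) (h1 x) y' (g x) fun i hi => ?_
    have h4 := h2 i x hi
    rw [hg1' x hx'] at h4
    have h5 : dist (y' i) (y i) < 1/2 := (dist_le_pi_dist y' y i).trans_lt hy'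
    rw [← dist_eq_norm]
    calc dist (y' i) (g x) ≤ dist (y' i) (y i) + dist (y i) (g x) := dist_triangle _ _ _
      _ < 1 := by rw [dist_comm (y i)]; linarith

end Cover



section CoverConverse

lemma shrink_step {X : Type*} [TopologicalSpace X] {n : ℕ} (h : Rem X (Fin (n + 1) → ℝ))
    {ι : Type*} [Fintype ι] (U : ι → Set X) (hU : ∀ i, FunctionallyOpen (U i))
    (hcov : ∀ x, ∃ i, x ∈ U i) (J : Finset ι) (hJ : J.card = n + 2) :
    ∃ V : ι → Set X, (∀ i, FunctionallyOpen (V i)) ∧ (∀ x, ∃ i, x ∈ V i) ∧ (∀ i, V i ⊆ U i) ∧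
      ∀ x, ∃ i ∈ J, x ∉ V i := by
  classical
  choose f hf using hU
  have hf' : ∀ i x, x ∈ U i ↔ f i x ≠ 0 := fun i x => by
    conv_lhs => rw [hf i]
    simp
  have hpos : ∀ x, 0 < ∑ i, |f i x| := fun x => by
    obtain ⟨i, hi⟩ := hcov x
    refine Finset.sum_pos' (fun _ _ => abs_nonneg _) ⟨i, Finset.mem_univ _, ?_⟩
    rw [abs_pos]
    exact (hf' i x).1 hi
  let φ : ι → C(X, ℝ) := fun i => ⟨fun x => |f i x| / ∑ j, |f j x|,
    Continuous.div (by fun_prop) (by fun_prop) fun x => (hpos x).ne'⟩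
  have hφ0 : ∀ i x, 0 ≤ φ i x := fun i x => div_nonneg (abs_nonneg _) (hpos x).le
  have hφ1 : ∀ x, ∑ i, φ i x = 1 := fun x => by
    simp only [φ, ContinuousMap.coe_mk]
    rw [← Finset.sum_div, div_self (hpos x).ne']
  have hφU : ∀ i x, x ∈ U i ↔ φ i x ≠ 0 := fun i x => by
    rw [hf' i x]
    simp only [φ, ContinuousMap.coe_mk, ne_eq, div_eq_zero_iff, (hpos x).ne', or_false, abs_eq_zero]
  obtain ⟨j₀, hj₀⟩ : J.Nonempty := Finset.card_pos.1 (by omega)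
  let J0 : Finset ι := J.erase j₀
  have hJ0 : J0.card = n + 1 := by simp [J0, Finset.card_erase_of_mem hj₀, hJ]
  have hJ0ne : J0.Nonempty := Finset.card_pos.1 (by omega)
  have h' : Rem X (J0 → ℝ) := h.congr_finrank (by simp [hJ0])
  let pl : C(X, ℝ) := ⟨fun x => ∑ i ∈ J0ᶜ, φ i x, by fun_prop⟩
  have hpl0 : ∀ x, 0 ≤ pl x := fun x => Finset.sum_nonneg fun i _ => hφ0 i x
  have hsum : ∀ x, ∑ l : J0, φ l x + pl x = 1 := fun x => by
    rw [← hφ1 x, Finset.sum_coe_sort J0 (fun i => φ i x)]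
    exact Finset.sum_add_sum_compl _ _
  let K : ℝ := 2 * (n + 2)
  have hK : 0 < K := by positivity
  let g : C(X, J0 → ℝ) := ⟨fun x l => K * (φ l x - pl x), by fun_prop⟩
  obtain ⟨g', h1, h2⟩ := h' g
  have key : ∀ x, (pl x = 0 ∨ ∃ l : J0, φ l x = 0) → g' x = g x := fun x hx => by
    refine h2 x ?_
    by_contra hlt
    push Not at hlt
    have h3 : ∀ l : J0, |φ l x - pl x| < 1 / K := fun l => by
      have h4 := (norm_le_pi_norm (g x) l).trans_lt hlt
      simp only [g, ContinuousMap.coe_mk, Real.norm_eq_abs, abs_mul, abs_of_pos hK] at h4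
      rw [lt_div_iff₀ hK]; linarith
    have h4 : pl x < 1 / K := by
      rcases hx with hx | ⟨l, hl⟩
      · rw [hx]; positivity
      · have := h3 l
        rw [hl, zero_sub, abs_neg] at this
        exact (le_abs_self _).trans_lt this
    have h5 : ∑ l : J0, φ l x ≤ ∑ l : J0, 2 / K := Finset.sum_le_sum fun l _ => by
      have := (le_abs_self _).trans_lt (h3 l)
      have : 2 / K = 1 / K + 1 / K := by ring
      linarith
    have h6 := hsum x
    simp only [Finset.sum_const, Finset.card_univ, Fintype.card_coe, hJ0, nsmul_eq_mul] at h5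
    have h7 : ((n + 1 : ℕ) : ℝ) * (2 / K) + 1 / K < 1 := by
      rw [← mul_div_assoc, ← add_div, div_lt_one hK]
      push_cast
      simp only [K]
      linarith
    linarith
  let ψ : J0 → C(X, ℝ) := fun l => ⟨fun x => max 0 (g' x l) + ∑ j, max 0 (g' x l - g' x j),
    by fun_prop⟩
  let ψl : C(X, ℝ) := ⟨fun x => ∑ j, max 0 (- g' x j), by fun_prop⟩
  have hψU : ∀ (l : J0) x, ψ l x ≠ 0 → φ l x ≠ 0 := fun l x hx h0 => by
    refine hx ?_
    have h3 := key x (Or.inr ⟨l, h0⟩)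
    simp only [ψ, ContinuousMap.coe_mk, h3, g, h0]
    have h4 : K * (0 - pl x) ≤ 0 := by nlinarith [hpl0 x]
    rw [max_eq_left h4, zero_add]
    refine Finset.sum_eq_zero fun j _ => max_eq_left ?_
    nlinarith [hφ0 j x]
  have hψlU : ∀ x, ψl x ≠ 0 → pl x ≠ 0 := fun x hx h0 => by
    refine hx ?_
    have h3 := key x (Or.inl h0)
    simp only [ψl, ContinuousMap.coe_mk, h3, g, h0]
    refine Finset.sum_eq_zero fun j _ => max_eq_left ?_
    nlinarith [hφ0 j x]
  refine ⟨fun i => if hi : i ∈ J0 then {x | ψ ⟨i, hi⟩ x ≠ 0} else {x | φ i x * ψl x ≠ 0},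
    fun i => ?_, fun x => ?_, fun i => ?_, fun x => ?_⟩
  · by_cases hi : i ∈ J0
    · simp only [hi, dite_true]
      exact ⟨ψ ⟨i, hi⟩, by ext; simp⟩
    · simp only [hi, dite_false]
      exact ⟨φ i * ψl, by ext; simp⟩
  · by_contra hc
    push Not at hc
    have h3 : ∀ l, ψ l x = 0 := fun l => by
      have := hc l
      simpa using this
    have h4 : ψl x = 0 := by
      by_contra h5
      have h6 := hψlU x h5
      obtain ⟨i, hi, hi'⟩ := Finset.exists_ne_zero_of_sum_ne_zero h6
      have := hc i
      rw [Finset.mem_compl] at hi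
      simp [hi, hi', h5] at this
    refine h1 x (funext fun l => le_antisymm ?_ ?_)
    · have h5 := h3 l
      simp only [ψ, ContinuousMap.coe_mk] at h5
      have h6 : 0 ≤ ∑ j, max 0 (g' x l - g' x j) := Finset.sum_nonneg fun j _ => le_max_left _ _
      have h7 := le_max_right 0 (g' x l)
      simp only [Pi.zero_apply]
      linarith
    · have h5 := (Finset.sum_eq_zero_iff_of_nonneg (fun j _ => le_max_left _ _)).1 h4 l
        (Finset.mem_univ _)
      have := le_max_right 0 (- g' x l)
      simp only [Pi.zero_apply]
      linarith
  · by_cases hi : i ∈ J0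
    · simp only [hi, dite_true]
      exact fun x hx => (hφU i x).2 (hψU ⟨i, hi⟩ x hx)
    · simp only [hi, dite_false]
      exact fun x hx => (hφU i x).2 (left_ne_zero_of_mul hx)
  · by_contra hc
    push Not at hc
    have hl : ψl x ≠ 0 := by
      have := hc j₀ hj₀
      simp only [J0, Finset.notMem_erase, dite_false] at this
      exact right_ne_zero_of_mul this
    have hJ' : Nonempty J0 := hJ0ne.to_subtype
    obtain ⟨j, hj⟩ := Finite.exists_min (fun j : J0 => g' x j)
    have h3 : ψ j x ≠ 0 := by
      have := hc j (Finset.mem_of_mem_erase j.2)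
      simpa using this
    have h4 : 0 < g' x j := by
      by_contra h5
      push Not at h5
      refine h3 ?_
      simp only [ψ, ContinuousMap.coe_mk]
      rw [max_eq_left h5, zero_add]
      exact Finset.sum_eq_zero fun k _ => max_eq_left (by linarith [hj k])
    refine hl (Finset.sum_eq_zero fun k _ => max_eq_left ?_)
    linarith [hj k]

lemma covDimLE_of_rem {X : Type*} [TopologicalSpace X] {n : ℕ} (h : Rem X (Fin (n + 1) → ℝ)) :
    CovDimLE X n := by
  classical
  intro 𝒰 hU hcov
  have main : ∀ 𝒥 : Finset (Finset 𝒰), (∀ J ∈ 𝒥, J.card = n + 2) →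
      ∃ V : 𝒰 → Set X, (∀ i, FunctionallyOpen (V i)) ∧ (∀ x, ∃ i, x ∈ V i) ∧
      (∀ i : 𝒰, V i ⊆ i) ∧ ∀ J ∈ 𝒥, ∀ x, ∃ i ∈ J, x ∉ V i := by
    intro 𝒥
    induction 𝒥 using Finset.induction_on with
    | empty =>
      intro _
      refine ⟨fun i => i, fun i => hU i i.2, fun x => ?_, fun i => le_rfl, by simp⟩
      have : x ∈ ⋃₀ (𝒰 : Set (Set X)) := by rw [hcov]; trivial
      obtain ⟨U, hU, hx⟩ := this
      exact ⟨⟨U, hU⟩, hx⟩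
    | insert J 𝒥 _ ih =>
      intro hc
      obtain ⟨V, h1, h2, h3, h4⟩ := ih fun J hJ => hc J (by simp [hJ])
      obtain ⟨V', h1', h2', h3', h4'⟩ := shrink_step h V h1 h2 J (hc J (by simp))
      refine ⟨V', h1', h2', fun i => (h3' i).trans (h3 i), fun J' hJ' x => ?_⟩
      rcases Finset.mem_insert.1 hJ' with rfl | hJ'
      · exact h4' x
      · obtain ⟨i, hi, hx⟩ := h4 J' hJ' x
        exact ⟨i, hi, fun hx' => hx (h3' i hx')⟩
  obtain ⟨V, h1, h2, h3, h4⟩ := main (Finset.univ.filter fun J => J.card = n + 2) (by simp)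
  refine ⟨Finset.univ.image V, ?_, ?_, ?_, fun 𝒲 hW hc => ?_⟩
  · intro W hW
    obtain ⟨i, -, rfl⟩ := Finset.mem_image.1 hW
    exact h1 i
  · refine eq_univ_of_forall fun x => ?_
    obtain ⟨i, hi⟩ := h2 x
    exact ⟨V i, by simp, hi⟩
  · intro W hW
    obtain ⟨i, -, rfl⟩ := Finset.mem_image.1 hW
    exact ⟨i, i.2, h3 i⟩
  · obtain ⟨J', -, hJ', hcard⟩ : ∃ J' ⊆ (Finset.univ : Finset 𝒰), J'.image V = 𝒲 ∧ J'.card = 𝒲.card := by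
      obtain ⟨s, hs, hi⟩ := Finset.exists_subset_injOn_image_eq_of_surjOn (Finset.univ : Finset 𝒰) 𝒲
        (f := V) (fun W hW' => by
          obtain ⟨i, hi, rfl⟩ := Finset.mem_image.1 (hW hW')
          exact ⟨i, by simp, rfl⟩)
      exact ⟨s, fun i _ => by simp, hi.2, by rw [← hi.2, Finset.card_image_of_injOn hi.1]⟩
    obtain ⟨J, hJJ', hJ⟩ := Finset.exists_subset_card_eq (show n + 2 ≤ J'.card by omega)
    refine eq_empty_of_forall_notMem fun x hx => ?_
    obtain ⟨i, hi, hxi⟩ := h4 J (Finset.mem_filter.2 ⟨Finset.mem_univ _, hJ⟩) x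
    refine hxi (hx _ ?_)
    rw [← hJ']
    simpa using ⟨i, i.2, hJJ' hi, rfl⟩

lemma covDimLE_iff {X : Type*} [TopologicalSpace X] {n : ℕ} :
    CovDimLE X n ↔ Rem X (Fin (n + 1) → ℝ) := ⟨rem_of_covDimLE, covDimLE_of_rem⟩

end CoverConverse



section Glicksberg

lemma exists_stoneCech_ext {X : Type*} [TopologicalSpace X] (f : C(X, ℝ)) (hf : ∀ x, |f x| ≤ 1) :
    ∃ F : C(StoneCech X, ℝ), ∀ x, F (stoneCechUnit x) = f x := by
  have hc : Continuous (fun x => (⟨f x, abs_le.1 (hf x)⟩ : Icc (-1 : ℝ) 1)) := by fun_prop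
  refine ⟨⟨fun p => Subtype.val (stoneCechExtend hc p),
    continuous_subtype_val.comp (continuous_stoneCechExtend hc)⟩, fun x => ?_⟩
  simp [stoneCechExtend_stoneCechUnit]

lemma rem_stoneCech_iff {X : Type*} [TopologicalSpace X] {k : ℕ} :
    Rem X (Fin k → ℝ) ↔ Rem (StoneCech X) (Fin k → ℝ) :=
  rem_iff_of_extends ⟨stoneCechUnit, continuous_stoneCechUnit⟩ denseRange_stoneCechUnit
    exists_stoneCech_ext

lemma CountablyCompact.exists_univ {X : Type*} [TopologicalSpace X] (h : CountablyCompact X)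
    (W : ℕ → Set X) (ho : ∀ n, IsOpen (W n)) (hm : Monotone W) (hc : ∀ x, ∃ n, x ∈ W n) :
    ∃ n, W n = univ := by
  obtain ⟨t, ht⟩ := h W ho (eq_univ_of_forall fun x => by simpa using hc x)
  refine ⟨t.sup id, eq_univ_of_forall fun x => ?_⟩
  have : x ∈ ⋃ n ∈ t, W n := by rw [ht]; trivial
  simp only [mem_iUnion] at this
  obtain ⟨n, hn, hx⟩ := this
  exact hm (Finset.le_sup (f := id) hn) hx

lemma CountablyCompact.exists_clusterPt {X : Type*} [TopologicalSpace X] (h : CountablyCompact X)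
    (x : ℕ → X) : ∃ a, MapClusterPt a Filter.atTop x := by
  by_contra hc
  push Not at hc
  obtain ⟨n, hn⟩ := h.exists_univ (fun n => (closure (x '' Ici n))ᶜ)
    (fun n => isClosed_closure.isOpen_compl)
    (fun m n hmn => compl_subset_compl.2 (closure_mono (image_mono (Ici_subset_Ici.2 hmn))))
    (fun a => by
      have := hc a
      rw [mapClusterPt_iff_frequently] at this
      push Not at this
      obtain ⟨s, hs, h1⟩ := this
      obtain ⟨n, hn⟩ := Filter.eventually_atTop.1 h1
      refine ⟨n, fun ha => ?_⟩
      obtain ⟨y, hy, ⟨m, hm, rfl⟩⟩ := mem_closure_iff_nhds.1 ha s hs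
      exact hn m hm hy)
  have : x n ∈ (closure (x '' Ici n))ᶜ := by
    have h' : (closure (x '' Ici n))ᶜ = univ := hn
    rw [h']; trivial
  exact this (subset_closure ⟨n, self_mem_Ici, rfl⟩)

lemma CountablyCompact.isCompact_range {X Y : Type*} [TopologicalSpace X] [PseudoMetricSpace Y]
    (h : CountablyCompact X) {F : X → Y} (hF : Continuous F) : IsCompact (range F) := by
  refine IsSeqCompact.isCompact ?_
  intro u hu
  choose x hx using hu
  obtain ⟨a, ha⟩ := h.exists_clusterPt x
  have h1 : MapClusterPt (F a) Filter.atTop (F ∘ x) := ha.continuousAt_comp hF.continuousAt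
  obtain ⟨ψ, hψ, ht⟩ := MapClusterPt.tendsto_subseq h1
  refine ⟨F a, mem_range_self a, ψ, hψ, ?_⟩
  have : F ∘ x = u := funext hx
  rwa [this] at ht

lemma glicksberg {X Y : Type*} [TopologicalSpace X] [TopologicalSpace Y]
    [FirstCountableTopology X] (hX : CountablyCompact X) (hY : CountablyCompact Y)
    (f : C(X × Y, ℝ)) (hf : ∀ p, |f p| ≤ 1) :
    ∃ F : C(StoneCech X × StoneCech Y, ℝ), ∀ p : X × Y,
      F (stoneCechUnit p.1, stoneCechUnit p.2) = f p := by
  have : ∀ x : X, ∃ F : C(StoneCech Y, ℝ), ∀ y, F (stoneCechUnit y) = f (x, y) := fun x => by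
    obtain ⟨F, hF⟩ := exists_stoneCech_ext (X := Y) ⟨fun y => f (x, y), by fun_prop⟩
      (fun y => hf _)
    exact ⟨F, hF⟩
  choose F hF using this
  have hFc : Continuous F := by
    rw [continuous_iff_continuousAt]
    intro x
    rw [Metric.continuousAt_iff']
    intro ε hε
    obtain ⟨U, hU⟩ := (𝓝 x).exists_antitone_basis
    obtain ⟨n, hn⟩ := hY.exists_univ
      (fun n => interior {y | ∀ x' ∈ U n, |f (x', y) - f (x, y)| ≤ ε / 2})
      (fun n => isOpen_interior)
      (fun m n hmn => interior_mono fun y hy x' hx' => hy x' (hU.antitone hmn hx'))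
      (fun y => by
        have h1 : ∀ᶠ p in 𝓝 (x, y), dist (f p) (f (x, y)) < ε / 4 :=
          Metric.continuousAt_iff'.1 f.continuous.continuousAt _ (by positivity)
        rw [nhds_prod_eq, (hU.1.prod (𝓝 y).basis_sets).eventually_iff] at h1
        obtain ⟨⟨n, V⟩, ⟨-, hV⟩, h2⟩ := h1
        refine ⟨n, mem_interior_iff_mem_nhds.2 (Filter.mem_of_superset hV fun y' hy' x' hx' => ?_)⟩
        have h3 : dist (f (x', y')) (f (x, y)) < ε / 4 := h2 (x := (x', y')) ⟨hx', hy'⟩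
        have h4 : dist (f (x, y')) (f (x, y)) < ε / 4 :=
          h2 (x := (x, y')) ⟨mem_of_mem_nhds (hU.1.mem_of_mem trivial), hy'⟩
        rw [Real.dist_eq, abs_lt] at h3 h4
        rw [abs_le]
        constructor <;> linarith [h3.1, h3.2, h4.1, h4.2])
    filter_upwards [hU.1.mem_of_mem (i := n) trivial] with x' hx'
    refine lt_of_le_of_lt ?_ (half_lt_self hε)
    rw [ContinuousMap.dist_le (by positivity)]
    intro q
    refine denseRange_stoneCechUnit.induction_on (p := fun q => dist (F x' q) (F x q) ≤ ε / 2) q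
      (isClosed_le (by fun_prop) (by fun_prop)) fun y => ?_
    rw [hF, hF, Real.dist_eq]
    have hy : y ∈ interior {y | ∀ x' ∈ U n, |f (x', y) - f (x, y)| ≤ ε / 2} := by
      have h' : interior {y | ∀ x' ∈ U n, |f (x', y) - f (x, y)| ≤ ε / 2} = univ := hn
      rw [h']; trivial
    exact interior_subset hy x' hx'
  have hcomp : CompactSpace (range F) := isCompact_iff_compactSpace.1 (hX.isCompact_range hFc)
  have hc : Continuous (rangeFactorization F) := by
    exact hFc.subtype_mk _
  refine ⟨⟨fun p => (Subtype.val (stoneCechExtend hc p.1) : C(StoneCech Y, ℝ)) p.2, ?_⟩, fun p => ?_⟩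
  · have h1 : Continuous fun p : StoneCech X × StoneCech Y =>
        ((Subtype.val (stoneCechExtend hc p.1) : C(StoneCech Y, ℝ)), p.2) :=
      (continuous_subtype_val.comp ((continuous_stoneCechExtend hc).comp continuous_fst)).prodMk
        continuous_snd
    exact ContinuousEval.continuous_eval.comp h1
  · simp only [ContinuousMap.coe_mk, stoneCechExtend_stoneCechUnit, rangeFactorization_coe]
    exact hF _ _

lemma rem_prod_stoneCech_iff {X Y : Type*} [TopologicalSpace X] [TopologicalSpace Y]
    [FirstCountableTopology X] (hX : CountablyCompact X) (hY : CountablyCompact Y) {k : ℕ} :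
    Rem (X × Y) (Fin k → ℝ) ↔ Rem (StoneCech X × StoneCech Y) (Fin k → ℝ) :=
  rem_iff_of_extends ⟨fun p => (stoneCechUnit p.1, stoneCechUnit p.2),
    (continuous_stoneCechUnit.comp continuous_fst).prodMk
      (continuous_stoneCechUnit.comp continuous_snd)⟩
    (denseRange_stoneCechUnit.prodMap denseRange_stoneCechUnit)
    (glicksberg hX hY)

lemma IsTopManifold.firstCountable {M : Type*} [TopologicalSpace M] {n : ℕ}
    (h : IsTopManifold M n) : FirstCountableTopology M := by
  refine ⟨fun x => ?_⟩
  obtain ⟨U, hU, hx, ⟨e⟩⟩ := h x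
  have : FirstCountableTopology U := e.isInducing.firstCountableTopology
  rw [show x = ((⟨x, hx⟩ : U) : M) from rfl, ← hU.isOpenEmbedding_subtypeVal.map_nhds_eq]
  infer_instance

end Glicksberg



section Stagger

variable {E : Type*} [NormedAddCommGroup E] [NormedSpace ℝ E]

/-- Staggered piecewise linear path with vertices `a i 0, …, a i (N+1)`. -/
noncomputable def stag {R : ℕ} (N : ℕ) (a : Fin R → ℕ → E) (i : Fin R) (t : ℝ) : E :=
  a i 0 + ∑ j ∈ Finset.range (N + 1),
    max 0 (min 1 ((R : ℝ) * N * t - j * R - (i : ℕ))) • (a i (j + 1) - a i j)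

lemma stag_continuous {R : ℕ} (N : ℕ) (a : Fin R → ℕ → E) (i : Fin R) :
    Continuous (stag N a i) := by
  unfold stag; fun_prop

/-- The offset of the `i`-th path while the `ρ`-th one is moving. -/
def stagOff {R : ℕ} (ρ i : Fin R) : ℕ := if i < ρ then 1 else 0

lemma stag_eq {R : ℕ} (hR : 0 < R) (N : ℕ) {t : ℝ} (h0 : 0 ≤ t) (h1 : t ≤ 1) :
    ∃ (q : ℕ) (ρ : Fin R) (s : ℝ), q ≤ N ∧ 0 ≤ s ∧ s < 1 ∧ (q : ℝ) ≤ N * t ∧ N * t ≤ q + 1 ∧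
      ∀ (a : Fin R → ℕ → E) (i : Fin R), stag N a i t = a i (q + stagOff ρ i) +
        (if i = ρ then s else 0) • (a i (q + 1) - a i q) := by
  have hu0 : 0 ≤ (R : ℝ) * N * t := by positivity
  set p : ℕ := ⌊(R : ℝ) * N * t⌋₊ with hp
  have hp1 : (p : ℝ) ≤ (R : ℝ) * N * t := Nat.floor_le hu0
  have hp2 : (R : ℝ) * N * t < p + 1 := Nat.lt_floor_add_one _
  have hpR : (p : ℝ) = (p / R : ℕ) * R + (p % R : ℕ) := by
    have := Nat.div_add_mod' p R
    exact_mod_cast this.symm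
  set q := p / R with hq
  have hρ : p % R < R := Nat.mod_lt _ hR
  set ρ := p % R with hρdef
  have hρ' : (ρ : ℝ) + 1 ≤ R := by exact_mod_cast hρ
  have hR' : (0 : ℝ) < R := by exact_mod_cast hR
  have hqN : q ≤ N := by
    have h2 : p ≤ R * N := by
      have : (p : ℝ) ≤ (R * N : ℕ) := by
        push_cast
        refine hp1.trans ?_
        nlinarith [mul_nonneg hR'.le (Nat.cast_nonneg (α := ℝ) N)]
      exact_mod_cast this
    exact Nat.div_le_of_le_mul h2
  refine ⟨q, ⟨ρ, hρ⟩, (R : ℝ) * N * t - p, hqN, by linarith, by linarith, ?_, ?_, ?_⟩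
  · have : (R : ℝ) * q ≤ R * (N * t) := by
      have : (0 : ℝ) ≤ (ρ : ℝ) := by positivity
      nlinarith
    exact le_of_mul_le_mul_left this hR'
  · have : (R : ℝ) * (N * t) ≤ R * (q + 1) := by nlinarith
    exact le_of_mul_le_mul_left this hR'
  intro a i
  have hi : ((i : ℕ) : ℝ) + 1 ≤ R := by exact_mod_cast i.2
  have hi0 : (0 : ℝ) ≤ ((i : ℕ) : ℝ) := by positivity
  have hρ0 : (0 : ℝ) ≤ (ρ : ℝ) := by positivity
  unfold stag
  have hlt : ∀ j < q, max 0 (min 1 ((R : ℝ) * N * t - j * R - (i : ℕ))) = 1 := by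
    intro j hj
    have hj' : (j : ℝ) + 1 ≤ q := by exact_mod_cast hj
    have : 1 ≤ (R : ℝ) * N * t - j * R - (i : ℕ) := by nlinarith
    rw [min_eq_left this]; simp
  have hgt : ∀ j, q < j → max 0 (min 1 ((R : ℝ) * N * t - j * R - (i : ℕ))) = 0 := by
    intro j hj
    have hj' : (q : ℝ) + 1 ≤ j := by exact_mod_cast hj
    have : (R : ℝ) * N * t - j * R - (i : ℕ) ≤ 0 := by nlinarith
    exact max_eq_left ((min_le_right _ _).trans this)
  have hsplit : ∑ j ∈ Finset.range (N + 1),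
      max 0 (min 1 ((R : ℝ) * N * t - j * R - (i : ℕ))) • (a i (j + 1) - a i j) =
      (a i q - a i 0) +
        max 0 (min 1 ((R : ℝ) * N * t - q * R - (i : ℕ))) • (a i (q + 1) - a i q) := by
    rw [← Finset.sum_subset (Finset.range_mono (show q + 1 ≤ N + 1 by omega)) (fun j _ hj => by
      rw [hgt j (by simpa using hj), zero_smul]), Finset.sum_range_succ]
    congr 1
    rw [← Finset.sum_range_sub]
    refine Finset.sum_congr rfl fun j hj => ?_
    rw [hlt j (by simpa using hj), one_smul]
  rw [hsplit]
  have hθ : (R : ℝ) * N * t - q * R - (i : ℕ) = (ρ : ℝ) - (i : ℕ) + ((R : ℝ) * N * t - p) := by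
    rw [hpR]; ring
  rw [hθ]
  rcases lt_trichotomy (i : ℕ) ρ with h | h | h
  · have h' : ((i : ℕ) : ℝ) + 1 ≤ ρ := by exact_mod_cast h
    rw [min_eq_left (by linarith)]
    have hne : i ≠ ⟨ρ, hρ⟩ := fun hc => by rw [hc] at h; simp at h
    have hlt' : i < ⟨ρ, hρ⟩ := h
    simp [stagOff, hne, hlt']
  · have hne : i = ⟨ρ, hρ⟩ := Fin.ext h
    have h2 : min 1 ((ρ : ℝ) - (i : ℕ) + ((R : ℝ) * N * t - p)) = (R : ℝ) * N * t - p := by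
      rw [h, sub_self, zero_add]; exact min_eq_right (by linarith)
    rw [h2, max_eq_right (by linarith)]
    simp [stagOff, hne]
    abel
  · have h' : (ρ : ℝ) + 1 ≤ ((i : ℕ) : ℝ) := by exact_mod_cast h
    have hne : i ≠ ⟨ρ, hρ⟩ := fun hc => by rw [hc] at h; simp at h
    have hlt' : ¬ i < ⟨ρ, hρ⟩ := fun hc => by
      have : (i : ℕ) < ρ := hc
      omega
    rw [max_eq_left ((min_le_right _ _).trans (by linarith))]
    simp [stagOff, hne, hlt']

/-- Extension of a finite sequence by zero. -/
def extN {R N : ℕ} (a : Fin R → Fin (N + 2) → E) (i : Fin R) (j : ℕ) : E :=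
  if h : j < N + 2 then a i ⟨j, h⟩ else 0

/-- The staggered approximation of a homotopy. -/
noncomputable def stagMap {Z : Type*} [TopologicalSpace Z] {R : ℕ} (N : ℕ) (φ : Fin R → C(Z, ℝ))
    (a : Fin R → ℕ → E) : C(Z × unitInterval, E) :=
  ⟨fun p => ∑ i, φ i p.1 • stag N a i p.2, by
    have := fun i => stag_continuous N a i
    fun_prop⟩

/-- In a staggered approximation, at each time the map has a controlled form. -/
lemma stagMap_eq {Z : Type*} [TopologicalSpace Z] {R : ℕ} (hR : 0 < R) (N : ℕ) (t : unitInterval) :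
    ∃ (q : ℕ) (ρ : Fin R) (s : ℝ), q ≤ N ∧ (q : ℝ) ≤ N * (t : ℝ) ∧ N * (t : ℝ) ≤ q + 1 ∧
      ∀ (φ : Fin R → C(Z, ℝ)) (a : Fin R → ℕ → E) (z : Z), stagMap N φ a (z, t) =
        ∑ i, φ i z • a i (q + stagOff ρ i) + (φ ρ z * s) • (a ρ (q + 1) - a ρ q) := by
  obtain ⟨q, ρ, s, hq, hs0, hs1, h1, h2, h3⟩ := stag_eq (E := E) hR N t.2.1 t.2.2
  refine ⟨q, ρ, s, hq, h1, h2, fun φ a z => ?_⟩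
  simp only [stagMap, ContinuousMap.coe_mk, h3, smul_add, Finset.sum_add_distrib]
  congr 1
  rw [Finset.sum_eq_single ρ (fun i _ hi => by simp [hi]) (by simp)]
  simp [smul_smul]

lemma stagger {Z : Type*} [TopologicalSpace Z] [CompactSpace Z] {n : ℕ} (hZ : CovDimLE Z n)
    (H : C(Z × unitInterval, E)) {r : ℝ} (hr : 0 < r) :
    ∃ (R : ℕ) (φ : Fin R → C(Z, ℝ)), (∀ i x, 0 ≤ φ i x) ∧ (∀ x, ∑ i, φ i x = 1) ∧
      (∀ x (σ : Finset (Fin R)), (∀ i ∈ σ, φ i x ≠ 0) → σ.card ≤ n + 1) ∧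
      ∃ N₀ : ℕ, ∀ N ≥ N₀, ∃ a₀ : Fin R → Fin (N + 2) → E, ∀ a, dist a a₀ < r →
        ∀ p, ‖stagMap N φ (extN a) p - H p‖ < 3 * r := by
  obtain ⟨R, y, φ, h0, h1, h2, h3⟩ := cover_lemma hZ H.curry
    (isCompact_range H.curry.continuous).totallyBounded hr
  refine ⟨R, φ, h0, h1, h3, ?_⟩
  have huc : ∀ i, ∃ δ > 0, ∀ s t : unitInterval, dist s t < δ → dist (y i s) (y i t) < r :=
    fun i => by
      have := CompactSpace.uniformContinuous_of_continuous (y i).continuous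
      obtain ⟨δ, hδ, h⟩ := Metric.uniformContinuous_iff.1 this r hr
      exact ⟨δ, hδ, fun s t hst => h hst⟩
  choose δ hδ hδ' using huc
  have hN : ∃ N₀ : ℕ, 0 < N₀ ∧ ∀ i, ∀ N ≥ N₀, 1 / (N : ℝ) < δ i := by
    have : ∀ i, ∃ n : ℕ, 1 / ((n : ℝ) + 1) < δ i := fun i => exists_nat_one_div_lt (hδ i)
    choose n hn using this
    refine ⟨Finset.univ.sup n + 1, by omega, fun i N hN => lt_of_le_of_lt ?_ (hn i)⟩
    have h4 := Finset.le_sup (f := n) (Finset.mem_univ i)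
    have h5 : ((n i : ℕ) : ℝ) + 1 ≤ N := by exact_mod_cast (show n i + 1 ≤ N by omega)
    exact one_div_le_one_div_of_le (by positivity) h5
  obtain ⟨N₀, hN₀, hN₀'⟩ := hN
  refine ⟨N₀, fun N hN => ?_⟩
  have hNpos : (0 : ℝ) < N := by exact_mod_cast (show 0 < N by omega)
  refine ⟨fun i j => y i (projIcc 0 1 zero_le_one ((j : ℕ) / (N : ℝ))), fun a ha p => ?_⟩
  obtain ⟨z, t⟩ := p
  have hR : 0 < R := by
    rcases Nat.eq_zero_or_pos R with rfl | h
    · have := h1 z; simp at this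
    · exact h
  obtain ⟨q, ρ, s, hq, hs0, hs1, hq1, hq2, hst⟩ := stag_eq (E := E) hR N t.2.1 t.2.2
  have hnear : ∀ i j, φ i z ≠ 0 → (j = q ∨ j = q + 1) →
      extN a i j ∈ Metric.ball (H (z, t)) (3 * r) := by
    intro i j hi hj
    have hjN : j < N + 2 := by omega
    have hτ : dist (projIcc (0 : ℝ) 1 zero_le_one ((j : ℝ) / (N : ℝ))) t < δ i := by
      refine lt_of_le_of_lt ?_ (hN₀' i N hN)
      have h5 : (t : unitInterval) = projIcc (0 : ℝ) 1 zero_le_one (t : ℝ) := by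
        rw [projIcc_val]
      rw [Subtype.dist_eq, h5, coe_projIcc, coe_projIcc]
      have h6 : |(j : ℝ) / N - t| ≤ 1 / N := by
        rw [show (j : ℝ) / N - t = (j - N * t) / N by field_simp, abs_div, abs_of_pos hNpos]
        refine div_le_div_of_nonneg_right ?_ hNpos.le
        rw [abs_le]
        rcases hj with rfl | rfl
        · constructor <;> linarith
        · push_cast; constructor <;> linarith
      rw [Real.dist_eq]
      refine le_trans ?_ h6
      refine (abs_max_sub_max_le_max _ _ _ _).trans ?_
      rw [sub_self, abs_zero]
      refine max_le (abs_nonneg _) ((abs_min_sub_min_le_max _ _ _ _).trans ?_)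
      simp
    have h7 : dist (extN a i j) (y i (projIcc 0 1 zero_le_one ((j : ℝ) / (N : ℝ)))) < r := by
      simp only [extN, hjN, dite_true]
      exact (dist_le_pi_dist (a i) (fun j : Fin (N + 2) =>
        y i (projIcc 0 1 zero_le_one ((j : ℕ) / (N : ℝ)))) ⟨j, hjN⟩).trans_lt
        ((dist_le_pi_dist a _ i).trans_lt ha)
    have h8 := hδ' i _ _ hτ
    have h9 : dist (H (z, t)) (y i t) < r :=
      (ContinuousMap.dist_apply_le_dist (f := H.curry z) (g := y i) t).trans_lt (h2 i z hi)
    rw [Metric.mem_ball]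
    rw [dist_comm] at h9
    calc _ ≤ dist (extN a i j) (y i (projIcc 0 1 zero_le_one ((j : ℝ) / (N : ℝ)))) +
          dist (y i (projIcc 0 1 zero_le_one ((j : ℝ) / (N : ℝ)))) (y i t) +
          dist (y i t) (H (z, t)) := dist_triangle4 _ _ _ _
      _ < 3 * r := by linarith
  refine dist_sum_lt (fun i => φ i z) (fun i => h0 i z) (h1 z) _ _ fun i hi => ?_
  rw [← dist_eq_norm, ← Metric.mem_ball, hst]
  by_cases hiρ : i = ρ
  · simp only [hiρ, if_true, stagOff, lt_irrefl, if_false, add_zero]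
    rw [hiρ] at hi
    have hc := convex_ball (H (z, t)) (3 * r)
    have := hc (hnear ρ q hi (Or.inl rfl)) (hnear ρ (q + 1) hi (Or.inr rfl))
      (show 0 ≤ 1 - s by linarith) hs0 (by ring)
    convert this using 1
    rw [sub_smul, smul_sub]; simp; abel
  · simp only [hiρ, if_false, zero_smul, add_zero]
    refine hnear i _ hi ?_
    unfold stagOff
    split_ifs
    · right; rfl
    · left; rfl

end Stagger



section Upper

set_option linter.unusedSectionVars false

variable {E : Type*} [NormedAddCommGroup E] [NormedSpace ℝ E]

lemma extN_add {R N : ℕ} (a b : Fin R → Fin (N + 2) → E) (i : Fin R) (j : ℕ) :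
    extN (a + b) i j = extN a i j + extN b i j := by
  unfold extN; split_ifs <;> simp

lemma extN_smul {R N : ℕ} (c : ℝ) (a : Fin R → Fin (N + 2) → E) (i : Fin R) (j : ℕ) :
    extN (c • a) i j = c • extN a i j := by
  unfold extN; split_ifs <;> simp

lemma extN_of_lt {R N : ℕ} (f : Fin R → ℕ → E) (i : Fin R) {j : ℕ} (hj : j < N + 2) :
    extN (fun i (j : Fin (N + 2)) => f i j) i j = f i j := by
  simp [extN, hj]

/-- The vectors relevant at time `(q, ρ)`. -/
def lamOne {R N : ℕ} (q : ℕ) (ρ : Fin R) (σ : Finset (Fin R)) :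
    (Fin R → Fin (N + 2) → E) →ₗ[ℝ] (Option σ → E) where
  toFun a o := match o with
    | none => extN a ρ (q + 1) - extN a ρ q
    | some i => extN a i (q + stagOff ρ i)
  map_add' a b := by
    ext o
    rcases o with _ | i
    · simp only [extN_add, Pi.add_apply]; abel
    · simp only [extN_add, Pi.add_apply]
  map_smul' c a := by
    ext o
    rcases o with _ | i
    · simp only [extN_smul, Pi.smul_apply, smul_sub, RingHom.id_apply]
    · simp only [extN_smul, Pi.smul_apply, RingHom.id_apply]

lemma lamOne_witness {R N k : ℕ} (q : ℕ) (hq : q ≤ N) (ρ : Fin R) (σ : Finset (Fin R))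
    (hσ : σ.card + 1 ≤ k) :
    ∃ a : Fin R → Fin (N + 2) → (Fin k → ℝ), LinearIndependent ℝ (lamOne q ρ σ a) := by
  classical
  have : ∃ f : Option σ → Fin k, Function.Injective f := by
    have : Fintype.card (Option σ) ≤ Fintype.card (Fin k) := by simpa using hσ
    exact ⟨_, (Function.Embedding.nonempty_of_card_le this).some.injective⟩
  obtain ⟨f, hf⟩ := this
  have hb := (Pi.basisFun ℝ (Fin k)).linearIndependent.comp f hf
  set b := Pi.basisFun ℝ (Fin k)
  let A : Fin R → ℕ → (Fin k → ℝ) := fun i j =>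
    (if hi : i ∈ σ then b (f (some ⟨i, hi⟩)) else 0) + if i = ρ ∧ j = q + 1 then b (f none) else 0
  refine ⟨fun i j => A i j, ?_⟩
  have heq : lamOne q ρ σ (fun i (j : Fin (N + 2)) => A i j) = b ∘ f := by
    funext o
    rcases o with _ | i
    · change extN (fun i (j : Fin (N + 2)) => A i j) ρ (q + 1) -
        extN (fun i (j : Fin (N + 2)) => A i j) ρ q = _
      rw [extN_of_lt A ρ (by omega), extN_of_lt A ρ (by omega)]
      simp [A]
    · change extN (fun i (j : Fin (N + 2)) => A i j) i (q + stagOff ρ i) = _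
      rw [extN_of_lt A i (by unfold stagOff; split_ifs <;> omega)]
      have hno : ¬ ((i : Fin R) = ρ ∧ q + stagOff ρ i = q + 1) := by
        rintro ⟨h1, h2⟩
        rw [h1] at h2
        simp [stagOff] at h2
      simp only [A, hno, if_false, add_zero, i.2, dite_true, Function.comp]
  rw [heq]
  exact hb

lemma rem_prod_I {Z : Type*} [TopologicalSpace Z] [CompactSpace Z] {n : ℕ} (hZ : CovDimLE Z n) :
    Rem (Z × unitInterval) (Fin (n + 2) → ℝ) := by
  classical
  refine rem_of_approx fun g => ?_
  obtain ⟨R, φ, h0, h1, h2, N, hN⟩ := stagger hZ g (r := 1/3) (by norm_num)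
  obtain ⟨a₀, ha₀⟩ := hN N le_rfl
  obtain ⟨a, ha, hind⟩ := generic (Y := Fin R → Fin (N + 2) → (Fin (n + 2) → ℝ))
    (E := Fin (n + 2) → ℝ)
    (C := Fin (N + 1) × Fin R × {σ : Finset (Fin R) // σ.card ≤ n + 1})
    (κ := fun c => Option c.2.2.1)
    (fun c => lamOne c.1 c.2.1 c.2.2.1)
    (fun c => lamOne_witness c.1 (by omega) c.2.1 c.2.2.1 (by have := c.2.2.2; omega))
    a₀ (r := 1/3) (by norm_num)
  refine ⟨stagMap N φ (extN a), ?_, fun x _ _ => by simpa using ha₀ a ha x⟩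
  rintro ⟨z, t⟩ hzero
  have hR : 0 < R := by
    rcases Nat.eq_zero_or_pos R with rfl | h
    · have := h1 z; simp at this
    · exact h
  obtain ⟨q, ρ, s, hq, -, -, hst⟩ := stagMap_eq (E := Fin (n + 2) → ℝ) (Z := Z) hR N t
  rw [hst] at hzero
  let σ : Finset (Fin R) := Finset.univ.filter fun i => φ i z ≠ 0
  have hσ : σ.card ≤ n + 1 := h2 z σ (by simp [σ])
  have hl := hind (⟨q, by omega⟩, ρ, ⟨σ, hσ⟩)
  rw [Fintype.linearIndependent_iff] at hl
  have h4 := hl (fun o => match o with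
    | none => φ ρ z * s
    | some i => φ i z) (by
      rw [Fintype.sum_option]
      refine Eq.trans (add_comm _ _) (Eq.trans ?_ hzero)
      congr 1
      change ∑ i : σ, φ i z • extN a i (q + stagOff ρ i) = _
      rw [Finset.sum_coe_sort σ (fun i => φ i z • extN a i (q + stagOff ρ i))]
      refine Finset.sum_subset (Finset.subset_univ _) fun i _ hi => ?_
      simp only [σ, Finset.mem_filter, Finset.mem_univ, true_and, not_not] at hi
      simp [hi])
  have h5 : ∀ i, φ i z = 0 := fun i => by
    by_contra hi
    exact hi (h4 (some ⟨i, by simpa [σ] using hi⟩))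
  have := h1 z
  simp [h5] at this

end Upper



section LowerSmall

lemma uniform_time {Z Y : Type*} [TopologicalSpace Z] [CompactSpace Z] [PseudoMetricSpace Y]
    (F : C(Z × unitInterval, Y)) {ε : ℝ} (hε : 0 < ε) :
    ∃ δ > 0, ∀ z (t t' : unitInterval), dist t t' < δ → dist (F (z, t)) (F (z, t')) < ε := by
  let S : Set (Z × unitInterval × unitInterval) :=
    {p | ε ≤ dist (F (p.1, p.2.1)) (F (p.1, p.2.2))}
  have hS : IsCompact S := (isClosed_le (by fun_prop) (by fun_prop)).isCompact
  rcases S.eq_empty_or_nonempty with h | hne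
  · refine ⟨1, one_pos, fun z t t' _ => ?_⟩
    by_contra hc
    push Not at hc
    have : (z, t, t') ∈ S := hc
    rw [h] at this
    exact this
  · obtain ⟨p, hp, hm⟩ := hS.exists_isMinOn hne (f := fun p => dist p.2.1 p.2.2) (by fun_prop)
    refine ⟨dist p.2.1 p.2.2, ?_, fun z t t' ht => ?_⟩
    · refine lt_of_le_of_ne dist_nonneg fun h0 => ?_
      have h1 : p.2.1 = p.2.2 := dist_eq_zero.1 h0.symm
      have h2 : ε ≤ dist (F (p.1, p.2.1)) (F (p.1, p.2.2)) := hp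
      rw [h1, dist_self] at h2
      linarith
    · by_contra hc
      push Not at hc
      have h3 : dist p.2.1 p.2.2 ≤ dist t t' := hm (show (z, t, t') ∈ S from hc)
      linarith

lemma lower_start {Z E : Type*} [TopologicalSpace Z] [NormedAddCommGroup E] [NormedSpace ℝ E]
    (h : Rem (Z × unitInterval) (E × ℝ)) (g : C(Z, E)) :
    ∃ (H : C(Z × unitInterval, E)) (η : C(Z × unitInterval, ℝ)),
      (∀ p, H p = 0 → η p ≠ 0) ∧ (∀ z t, 1 ≤ ‖g z‖ → H (z, t) = g z) ∧
      (∀ z, η (z, 0) < 0) ∧ (∀ z, 0 < η (z, 1)) ∧ ∀ z, H (z, 0) = g z := by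
  obtain ⟨G, h1, h2⟩ := h ⟨fun p => (g p.1, 4 * (p.2 : ℝ) - 2), by fun_prop⟩
  have h20 : ∀ z, G (z, 0) = (g z, -2) := fun z => by
    have := h2 (z, 0) (by simp [Prod.norm_def])
    simpa using this
  have h21 : ∀ z, G (z, 1) = (g z, 2) := fun z => by
    have := h2 (z, 1) (by norm_num [Prod.norm_def])
    rw [this]; norm_num
  refine ⟨⟨fun p => (G p).1, by fun_prop⟩, ⟨fun p => (G p).2, by fun_prop⟩, fun p hp hp' => ?_,
    fun z t hz => ?_, fun z => ?_, fun z => ?_, fun z => ?_⟩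
  · exact h1 p (Prod.ext hp hp')
  · have := h2 (z, t) (by simp [Prod.norm_def, hz])
    simp [this]
  · simp [h20]
  · simp [h21]
  · simp [h20]

lemma lower_zero {Z : Type*} [TopologicalSpace Z]
    (h : Rem (Z × unitInterval) ((Fin 0 → ℝ) × ℝ)) : Rem Z (Fin 0 → ℝ) := by
  intro g
  obtain ⟨H, η, h1, -, h2, h3, -⟩ := lower_start h g
  refine ⟨g, fun z => ?_, fun _ _ => rfl⟩
  exfalso
  have hc : Continuous fun t : unitInterval => η (z, t) := by fun_prop
  obtain ⟨t, ht⟩ := mem_range_of_exists_le_of_exists_ge hc ⟨0, (h2 z).le⟩ ⟨1, (h3 z).le⟩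
  exact h1 (z, t) (Subsingleton.elim _ _) ht

variable {𝕜 : Type*} [RCLike 𝕜]

/-- The projection with entries `1 - c, B, conj B, c`. -/
noncomputable def prj (c : ℝ) (B : 𝕜) (v : 𝕜 × 𝕜) : 𝕜 × 𝕜 :=
  ((1 - (c : 𝕜)) * v.1 + B * v.2, (starRingEnd 𝕜) B * v.1 + (c : 𝕜) * v.2)

lemma prj_prj {c : ℝ} {B : 𝕜} (h : ‖B‖ ^ 2 = c * (1 - c)) (v : 𝕜 × 𝕜) :
    prj c B (prj c B v) = prj c B v := by
  have h' : B * (starRingEnd 𝕜) B = (c : 𝕜) * (1 - c) := by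
    rw [RCLike.mul_conj]
    exact_mod_cast congrArg (RCLike.ofReal (K := 𝕜)) h
  unfold prj
  ext
  · simp only
    linear_combination v.1 * h'
  · simp only
    linear_combination v.2 * h'

lemma prj_sub_le (c c' : ℝ) (B B' : 𝕜) (hc : dist c c' ≤ 1/4) (hB : dist B B' ≤ 1/4) (v : 𝕜 × 𝕜) :
    ‖prj c B v - prj c' B' v‖ ≤ ‖v‖ / 2 := by
  have e1 : prj c B v - prj c' B' v =
      (((c' - c : ℝ) : 𝕜) * v.1 + (B - B') * v.2,
        (starRingEnd 𝕜) (B - B') * v.1 + ((c - c' : ℝ) : 𝕜) * v.2) := by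
    unfold prj
    ext
    · simp; ring
    · simp; ring
  have hv1 := norm_fst_le v
  have hv2 := norm_snd_le v
  have hv := norm_nonneg v
  rw [Real.dist_eq] at hc
  rw [dist_eq_norm] at hB
  rw [e1, Prod.norm_def]
  refine max_le ((norm_add_le _ _).trans ?_) ((norm_add_le _ _).trans ?_)
  · simp only [norm_mul, RCLike.norm_ofReal]
    rw [abs_sub_comm]
    have := mul_le_mul hc hv1 (norm_nonneg _) (by norm_num)
    have := mul_le_mul hB hv2 (norm_nonneg _) (by norm_num)
    linarith
  · simp only [norm_mul, RCLike.norm_ofReal, RCLike.norm_conj]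
    have := mul_le_mul hc hv2 (norm_nonneg _) (by norm_num)
    have := mul_le_mul hB hv1 (norm_nonneg _) (by norm_num)
    linarith

lemma transport {Z : Type*} [TopologicalSpace Z] [CompactSpace Z]
    (c : C(Z × unitInterval, ℝ)) (B : C(Z × unitInterval, 𝕜))
    (hid : ∀ p, ‖B p‖ ^ 2 = c p * (1 - c p)) (h0 : ∀ z, c (z, 0) = 0) :
    ∃ s : C(Z × unitInterval, 𝕜 × 𝕜), (∀ z, s (z, 0) = (1, 0)) ∧
      ∀ p, s p ≠ 0 ∧ prj (c p) (B p) (s p) = s p := by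
  have hB0 : ∀ z, B (z, 0) = 0 := fun z => by
    have := hid (z, 0)
    rw [h0] at this
    simpa using this
  obtain ⟨δ₁, hδ₁, hc⟩ := uniform_time c (show (0 : ℝ) < 1/4 by norm_num)
  obtain ⟨δ₂, hδ₂, hB⟩ := uniform_time B (show (0 : ℝ) < 1/4 by norm_num)
  obtain ⟨n, hn⟩ := exists_nat_one_div_lt (lt_min hδ₁ hδ₂)
  have hpr : ∀ z, prj (c (z, 0)) (B (z, 0)) ((1, 0) : 𝕜 × 𝕜) = (1, 0) := fun z => by
    simp [prj, h0, hB0]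
  have main : ∀ k : ℕ, ∃ s : C(Z × unitInterval, 𝕜 × 𝕜), (∀ z, s (z, 0) = (1, 0)) ∧
      ∀ z (t : unitInterval), (t : ℝ) ≤ k * (1 / ((n : ℝ) + 1)) →
        s (z, t) ≠ 0 ∧ prj (c (z, t)) (B (z, t)) (s (z, t)) = s (z, t) := by
    intro k
    induction k with
    | zero =>
      refine ⟨ContinuousMap.const _ (1, 0), fun z => rfl, fun z t ht => ?_⟩
      have : t = 0 := by
        have h1 := t.2.1
        simp only [Nat.cast_zero, zero_mul] at ht
        exact Subtype.ext (le_antisymm ht h1)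
      rw [this]
      exact ⟨by simp, hpr z⟩
    | succ k ih =>
      obtain ⟨s, hs0, hs⟩ := ih
      let τ : unitInterval := projIcc 0 1 zero_le_one (k * (1 / ((n : ℝ) + 1)))
      have hk0 : (0 : ℝ) ≤ k * (1 / ((n : ℝ) + 1)) := by positivity
      have hτ : (τ : ℝ) ≤ k * (1 / ((n : ℝ) + 1)) := by
        simp only [τ, coe_projIcc]
        exact max_le hk0 (min_le_right _ _)
      refine ⟨⟨fun p => prj (c p) (B p) (s (p.1, min p.2 τ)), ?_⟩, fun z => ?_, fun z t ht => ?_⟩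
      · have h1 : Continuous fun p => (c p : 𝕜) := RCLike.continuous_ofReal.comp c.continuous
        have h2 : Continuous fun p => (starRingEnd 𝕜) (B p) := RCLike.continuous_conj.comp B.continuous
        unfold prj
        fun_prop
      · have : min (0 : unitInterval) τ = 0 := min_eq_left τ.2.1
        simp only [ContinuousMap.coe_mk, this, hs0, hpr]
      · simp only [ContinuousMap.coe_mk]
        refine ⟨?_, prj_prj (hid _) _⟩
        rcases le_total t τ with h | h
        · rw [min_eq_left h]
          have := hs z t ((show (t : ℝ) ≤ τ from h).trans hτ)
          rw [this.2]
          exact this.1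
        · rw [min_eq_right h]
          obtain ⟨h1, h2⟩ := hs z τ hτ
          have hd : dist t τ < min δ₁ δ₂ := by
            refine lt_of_le_of_lt ?_ hn
            rw [Subtype.dist_eq, Real.dist_eq, abs_of_nonneg (sub_nonneg.2 (show (τ : ℝ) ≤ t from h))]
            have h4 : min 1 ((k : ℝ) * (1 / ((n : ℝ) + 1))) ≤ τ := by
              simp only [τ, coe_projIcc]
              exact le_max_right _ _
            have h5 : (t : ℝ) ≤ 1 := t.2.2
            have h6 : (0 : ℝ) < 1 / ((n : ℝ) + 1) := by positivity
            push_cast at ht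
            rcases min_choice 1 ((k : ℝ) * (1 / ((n : ℝ) + 1))) with h7 | h7 <;>
              rw [h7] at h4 <;> linarith
          have h3 := prj_sub_le _ _ _ _ (hc z t τ (hd.trans_le (min_le_left _ _))).le
            (hB z t τ (hd.trans_le (min_le_right _ _))).le (s (z, τ))
          intro h4
          rw [h4, h2, zero_sub, norm_neg] at h3
          have := norm_pos_iff.2 h1
          linarith
  obtain ⟨s, hs0, hs⟩ := main (n + 1)
  refine ⟨s, hs0, fun p => hs p.1 p.2 ?_⟩
  have h5 : (p.2 : ℝ) ≤ 1 := p.2.2.2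
  push_cast
  rw [mul_one_div_cancel (by positivity)]
  exact h5

lemma lower_rclike {Z : Type*} [TopologicalSpace Z] [CompactSpace Z]
    (h : Rem (Z × unitInterval) (𝕜 × ℝ)) : Rem Z 𝕜 := by
  refine Rem.of_scale (r := 2) two_pos fun g => ?_
  have : NormedSpace ℝ 𝕜 := inferInstance
  obtain ⟨H, η, h1, h2, h3, h4, h5⟩ := lower_start h g
  let ρ : C(Z × unitInterval, ℝ) := ⟨fun p => max (η p) 0, by fun_prop⟩
  let D : C(Z × unitInterval, ℝ) := ⟨fun p => ‖H p‖ ^ 2 + ρ p ^ 2, by fun_prop⟩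
  have hD : ∀ p, D p = 0 → H p = 0 ∧ η p < 0 := fun p hp => by
    have e1 : ‖H p‖ ^ 2 + ρ p ^ 2 = 0 := hp
    have e2 : H p = 0 := by
      have : ‖H p‖ ^ 2 = 0 := by nlinarith [sq_nonneg ‖H p‖, sq_nonneg (ρ p)]
      simpa using this
    have e3 : ρ p = 0 := by
      have : ρ p ^ 2 = 0 := by nlinarith [sq_nonneg ‖H p‖, sq_nonneg (ρ p)]
      simpa using this
    refine ⟨e2, lt_of_le_of_ne ?_ (h1 p e2)⟩
    rw [← e3]; exact le_max_left _ _
  have hloc : ∀ p, D p = 0 → ∀ᶠ p' in 𝓝 p, ρ p' = 0 := fun p hp => by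
    filter_upwards [(isOpen_lt η.continuous continuous_const).mem_nhds (hD p hp).2] with p' hp'
    exact max_eq_right (le_of_lt hp')
  let c : C(Z × unitInterval, ℝ) := ⟨fun p => ρ p ^ 2 / D p, by
    rw [continuous_iff_continuousAt]
    intro p
    by_cases hp : D p = 0
    · refine ContinuousAt.congr (f := fun _ => (0 : ℝ)) continuousAt_const ?_
      filter_upwards [hloc p hp] with p' hp'
      simp [hp']
    · exact ContinuousAt.div (by fun_prop) (by fun_prop) hp⟩
  let B : C(Z × unitInterval, 𝕜) := ⟨fun p => ((ρ p / D p : ℝ) : 𝕜) * H p, by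
    rw [continuous_iff_continuousAt]
    intro p
    by_cases hp : D p = 0
    · refine ContinuousAt.congr (f := fun _ => (0 : 𝕜)) continuousAt_const ?_
      filter_upwards [hloc p hp] with p' hp'
      simp [hp']
    · refine ContinuousAt.mul ?_ (by fun_prop)
      exact RCLike.continuous_ofReal.continuousAt.comp
        (ContinuousAt.div (by fun_prop) (by fun_prop) hp)⟩
  obtain ⟨s, hs0, hs⟩ := transport c B (fun p => by
    simp only [c, B, ContinuousMap.coe_mk, norm_mul, RCLike.norm_ofReal, mul_pow, sq_abs]
    by_cases hp : D p = 0
    · simp [hp]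
    · have e1 : ‖H p‖ ^ 2 = D p - ρ p ^ 2 := by simp [D]
      rw [e1]; field_simp) (fun z => by
    have : ρ (z, 0) = 0 := max_eq_right (h3 z).le
    simp [c, this])
  have hsD : ∀ p, 0 < ‖(s p).1‖ ^ 2 + ‖(s p).2‖ ^ 2 := fun p => by
    by_contra hc
    push Not at hc
    refine (hs p).1 (Prod.ext ?_ ?_)
    · have : ‖(s p).1‖ ^ 2 = 0 := by nlinarith [sq_nonneg ‖(s p).1‖, sq_nonneg ‖(s p).2‖]
      simpa using this
    · have : ‖(s p).2‖ ^ 2 = 0 := by nlinarith [sq_nonneg ‖(s p).1‖, sq_nonneg ‖(s p).2‖]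
      simpa using this
  let κ : C(Z × unitInterval, 𝕜) := ⟨fun p =>
    (H p * (starRingEnd 𝕜) (s p).1 + (ρ p : 𝕜) * (starRingEnd 𝕜) (s p).2) /
      ((‖(s p).1‖ ^ 2 + ‖(s p).2‖ ^ 2 : ℝ) : 𝕜), by
    have e1 : Continuous fun p => (ρ p : 𝕜) := RCLike.continuous_ofReal.comp ρ.continuous
    have e2 : Continuous fun p => (starRingEnd 𝕜) (s p).1 := RCLike.continuous_conj.comp (by fun_prop)
    have e3 : Continuous fun p => (starRingEnd 𝕜) (s p).2 := RCLike.continuous_conj.comp (by fun_prop)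
    refine Continuous.div (by fun_prop) (RCLike.continuous_ofReal.comp (by fun_prop)) fun p => ?_
    exact RCLike.ofReal_ne_zero.2 (hsD p).ne'⟩
  have hκ0 : ∀ z, κ (z, 0) = g z := fun z => by simp [κ, hs0, h5]
  have hκ : ∀ p, D p ≠ 0 → κ p ≠ 0 := fun p hp hz => by
    have hp' : (D p : 𝕜) ≠ 0 := RCLike.ofReal_ne_zero.2 hp
    simp only [κ, ContinuousMap.coe_mk] at hz
    rw [div_eq_zero_iff] at hz
    rcases hz with hz | hz
    swap
    · exact RCLike.ofReal_ne_zero.2 (hsD p).ne' hz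
    have hz' : (starRingEnd 𝕜) (H p) * (s p).1 + (ρ p : 𝕜) * (s p).2 = 0 := by
      have := congrArg (starRingEnd 𝕜) hz
      simpa using this
    have e1 : (1 - (c p : 𝕜)) = H p * (starRingEnd 𝕜) (H p) / D p := by
      rw [RCLike.mul_conj]
      have : (1 - c p) = ‖H p‖ ^ 2 / D p := by
        simp only [c, ContinuousMap.coe_mk]
        rw [eq_div_iff hp, sub_mul, div_mul_cancel₀ _ hp]
        simp [D]
      exact_mod_cast congrArg (RCLike.ofReal (K := 𝕜)) this
    have e2 : B p = (ρ p : 𝕜) * H p / D p := by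
      simp only [B, ContinuousMap.coe_mk]
      push_cast
      ring
    have e3 : (starRingEnd 𝕜) (B p) = (ρ p : 𝕜) * (starRingEnd 𝕜) (H p) / D p := by
      rw [e2]; simp
    have e4 : (c p : 𝕜) = (ρ p : 𝕜) * ρ p / D p := by
      simp only [c, ContinuousMap.coe_mk]
      push_cast
      ring
    have hpr := (hs p).2
    refine (hs p).1 ?_
    rw [← hpr]
    unfold prj
    refine Prod.ext ?_ ?_
    · simp only [e1, e2, Prod.fst_zero]
      linear_combination (H p / D p) * hz'
    · simp only [e3, e4, Prod.snd_zero]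
      linear_combination (ρ p / D p : 𝕜) * hz'
  refine ⟨⟨fun z => κ (z, projIcc 0 1 zero_le_one (2 - ‖g z‖)), ?_⟩, fun z => ?_, fun z hz => ?_⟩
  · have : Continuous fun z => projIcc (0 : ℝ) 1 zero_le_one (2 - ‖g z‖) :=
      continuous_projIcc.comp (by fun_prop)
    fun_prop
  · simp only [ContinuousMap.coe_mk]
    refine hκ _ fun hd => ?_
    obtain ⟨e1, e2⟩ := hD _ hd
    rcases le_total ‖g z‖ 1 with hg | hg
    · rw [projIcc_of_right_le _ (by linarith)] at e2
      have : 0 < η (z, 1) := h4 z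
      exact lt_asymm this e2
    · rw [h2 _ _ hg] at e1
      rw [e1] at hg
      simp at hg
      linarith
  · simp only [ContinuousMap.coe_mk]
    rw [projIcc_of_le_left _ (by linarith)]
    exact hκ0 z

end LowerSmall



section LowerBig

variable {E : Type*} [NormedAddCommGroup E] [NormedSpace ℝ E]

/-- The vectors relevant at a pair of times `(q, ρ)`, `(q', ρ')`. -/
def lamTwo {R N : ℕ} (q : ℕ) (ρ : Fin R) (q' : ℕ) (ρ' : Fin R) (σ : Finset (Fin R)) :
    (Fin R → Fin (N + 2) → E) →ₗ[ℝ] (σ ⊕ Bool → E × E) where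
  toFun a o := match o with
    | Sum.inl i => (extN a i (q + stagOff ρ i), extN a i (q' + stagOff ρ' i))
    | Sum.inr true => (extN a ρ (q + 1) - extN a ρ q, 0)
    | Sum.inr false => (0, extN a ρ' (q' + 1) - extN a ρ' q')
  map_add' a b := by
    funext o
    rcases o with i | _ | _
    · simp only [extN_add, Pi.add_apply, Prod.mk_add_mk]
    · simp only [extN_add, Pi.add_apply, Prod.mk_add_mk, add_zero]
      congr 1; abel
    · simp only [extN_add, Pi.add_apply, Prod.mk_add_mk, add_zero]
      congr 1; abel
  map_smul' c a := by
    funext o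
    rcases o with i | _ | _
    · simp only [extN_smul, Pi.smul_apply, RingHom.id_apply, Prod.smul_mk]
    · simp only [extN_smul, Pi.smul_apply, smul_sub, RingHom.id_apply, Prod.smul_mk, smul_zero]
    · simp only [extN_smul, Pi.smul_apply, smul_sub, RingHom.id_apply, Prod.smul_mk, smul_zero]

lemma lamTwo_witness {R N m : ℕ} (hm : 3 ≤ m) (q : ℕ) (ρ : Fin R) (q' : ℕ) (ρ' : Fin R)
    (hqq : q + 1 < q') (hq : q' ≤ N) (σ : Finset (Fin R)) (hσ : σ.card ≤ m + 1) :
    ∃ a : Fin R → Fin (N + 2) → (Fin m → ℝ), LinearIndependent ℝ (lamTwo q ρ q' ρ' σ a) := by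
  classical
  let o : Fin m := ⟨0, by omega⟩
  let T := {x : Fin m ⊕ Fin m // x ≠ Sum.inl o ∧ x ≠ Sum.inr o}
  have hT : Fintype.card T = 2 * m - 2 := by
    have h1 : (Finset.univ.filter fun x : Fin m ⊕ Fin m => x ≠ Sum.inl o ∧ x ≠ Sum.inr o) =
        (Finset.univ.erase (Sum.inl o)).erase (Sum.inr o) := by
      ext x; simp [and_comm]
    rw [Fintype.card_subtype, h1, Finset.card_erase_of_mem (by simp),
      Finset.card_erase_of_mem (by simp)]
    simp
    omega
  have : ∃ f : σ → T, Function.Injective f := by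
    have : Fintype.card σ ≤ Fintype.card T := by
      rw [hT, Fintype.card_coe]; omega
    exact ⟨_, (Function.Embedding.nonempty_of_card_le this).some.injective⟩
  obtain ⟨f, hf⟩ := this
  let F : σ ⊕ Bool → Fin m ⊕ Fin m := fun x => match x with
    | Sum.inl i => (f i).1
    | Sum.inr true => Sum.inl o
    | Sum.inr false => Sum.inr o
  have hF : Function.Injective F := by
    rintro (i | _ | _) (j | _ | _) h
    · exact congrArg Sum.inl (hf (Subtype.ext h))
    · exact absurd h (f i).2.2
    · exact absurd h (f i).2.1
    · exact absurd h.symm (f j).2.2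
    · rfl
    · simp [F] at h
    · exact absurd h.symm (f j).2.1
    · simp [F] at h
    · rfl
  let b := (Pi.basisFun ℝ (Fin m)).prod (Pi.basisFun ℝ (Fin m))
  have hb := b.linearIndependent.comp F hF
  let e : Fin m → ℝ := Pi.basisFun ℝ (Fin m) o
  have hb1 : b (Sum.inl o) = (e, 0) := by ext <;> simp [b, e]
  have hb2 : b (Sum.inr o) = (0, e) := by ext <;> simp [b, e]
  let β : Fin R → (Fin m → ℝ) × (Fin m → ℝ) := fun i =>
    if hi : i ∈ σ then b (f ⟨i, hi⟩).1 else 0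
  let A : Fin R → ℕ → (Fin m → ℝ) := fun i j =>
    (if j ≤ q + 1 then (β i).1 else (β i).2) + (if i = ρ ∧ j = q + 1 then e else 0) +
      (if i = ρ' ∧ j = q' + 1 then e else 0)
  have hA1 : ∀ i, A i (q + stagOff ρ i) = (β i).1 := fun i => by
    have h1 : q + stagOff ρ i ≤ q + 1 := by unfold stagOff; split_ifs <;> omega
    have h2 : ¬ (i = ρ ∧ q + stagOff ρ i = q + 1) := by
      rintro ⟨h1, h2⟩
      rw [h1] at h2
      simp [stagOff] at h2
    have h3 : ¬ (i = ρ' ∧ q + stagOff ρ i = q' + 1) := by rintro ⟨-, h⟩; omega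
    simp only [A, h1, h2, h3, if_true, if_false, add_zero]
  have hA2 : ∀ i, A i (q' + stagOff ρ' i) = (β i).2 := fun i => by
    have h1 : ¬ q' + stagOff ρ' i ≤ q + 1 := by omega
    have h2 : ¬ (i = ρ ∧ q' + stagOff ρ' i = q + 1) := by rintro ⟨-, h⟩; omega
    have h3 : ¬ (i = ρ' ∧ q' + stagOff ρ' i = q' + 1) := by
      rintro ⟨h1, h2⟩
      rw [h1] at h2
      simp [stagOff] at h2
    simp only [A, h1, h2, h3, if_false, add_zero]
  have hA3 : A ρ (q + 1) - A ρ q = e := by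
    have h1 : ¬ (ρ = ρ' ∧ q = q') := by rintro ⟨-, h⟩; omega
    have h2 : ¬ (ρ = ρ' ∧ q = q' + 1) := by rintro ⟨-, h⟩; omega
    simp [A, h1, h2]
  have hA4 : A ρ' (q' + 1) - A ρ' q' = e := by
    have h1 : ¬ (q' + 1 ≤ q + 1) := by omega
    have h2 : ¬ (q' ≤ q + 1) := by omega
    have h3 : ¬ (ρ' = ρ ∧ q' + 1 = q + 1) := by rintro ⟨-, h⟩; omega
    have h4 : ¬ (ρ' = ρ ∧ q' = q + 1) := by rintro ⟨-, h⟩; omega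
    simp only [A, h1, h2, h3, h4, if_false, true_and, if_true, add_zero]
    simp
  refine ⟨fun i j => A i j, ?_⟩
  have hoff : ∀ (τ i : Fin R), stagOff τ i ≤ 1 := fun τ i => by unfold stagOff; split_ifs <;> omega
  have heq : lamTwo q ρ q' ρ' σ (fun i (j : Fin (N + 2)) => A i j) = b ∘ F := by
    funext x
    rcases x with i | _ | _
    · change (extN (fun i (j : Fin (N + 2)) => A i j) i (q + stagOff ρ i),
        extN (fun i (j : Fin (N + 2)) => A i j) i (q' + stagOff ρ' i)) = b (f i).1
      rw [extN_of_lt A i (by have := hoff ρ i; omega), extN_of_lt A i (by have := hoff ρ' i; omega),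
        hA1, hA2]
      simp [β]
    · change (0, extN (fun i (j : Fin (N + 2)) => A i j) ρ' (q' + 1) -
        extN (fun i (j : Fin (N + 2)) => A i j) ρ' q') = b (Sum.inr o)
      rw [extN_of_lt A ρ' (by omega), extN_of_lt A ρ' (by omega), hA4, hb2]
    · change (extN (fun i (j : Fin (N + 2)) => A i j) ρ (q + 1) -
        extN (fun i (j : Fin (N + 2)) => A i j) ρ q, 0) = b (Sum.inl o)
      rw [extN_of_lt A ρ (by omega), extN_of_lt A ρ (by omega), hA3, hb1]
  rw [heq]
  exact hb

lemma lower_big {Z : Type*} [TopologicalSpace Z] [CompactSpace Z] [T2Space Z] {m : ℕ} (hm : 3 ≤ m)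
    (h : Rem (Z × unitInterval) ((Fin m → ℝ) × ℝ)) : Rem Z (Fin m → ℝ) := by
  classical
  have hZ : CovDimLE Z m := by
    rw [covDimLE_iff]
    have h' : Rem (Z × unitInterval) (Fin (m + 1) → ℝ) := h.congr_finrank (by simp)
    have hc : Continuous fun z : Z => (z, (0 : unitInterval)) := by fun_prop
    refine h'.of_isClosedEmbedding (j := fun z => (z, 0)) (hc.isClosedEmbedding ?_)
    intro z z' hz
    exact (Prod.ext_iff.1 hz).1
  refine rem_of_approx fun g => ?_
  obtain ⟨H, η, h1, h2, h3, h4, -⟩ := lower_start h g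
  obtain ⟨ε, hε, hε1, hgap⟩ := gap_of_compact (X := Z × unitInterval) (E := (Fin m → ℝ) × ℝ)
    isCompact_univ ⟨fun p => (H p, η p), by fun_prop⟩ (fun p _ hp => by
      obtain ⟨e1, e2⟩ := Prod.ext_iff.1 hp
      exact h1 p e1 e2)
  have hgap' : ∀ p, ‖H p‖ < ε → ε ≤ |η p| := fun p hp => by
    have := hgap p trivial
    simp only [ContinuousMap.coe_mk, Prod.norm_def, le_max_iff, Real.norm_eq_abs] at this
    rcases this with h | h
    · linarith
    · exact h
  obtain ⟨δ, hδ, hδ'⟩ := uniform_time η hε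
  obtain ⟨R, φ, g0, g1, g2, N₀, hN⟩ := stagger hZ H (r := ε / 3) (by positivity)
  obtain ⟨k, hk⟩ := exists_nat_one_div_lt (half_pos hδ)
  let N := max N₀ (k + 1)
  obtain ⟨a₀, ha₀⟩ := hN N (le_max_left _ _)
  have hNk : (k : ℝ) + 1 ≤ N := by exact_mod_cast le_max_right N₀ (k + 1)
  have hNpos : (0 : ℝ) < N := by
    have : (0 : ℝ) ≤ k := by positivity
    linarith
  have hNδ : 2 < N * δ := by
    have e1 : 1 < (δ / 2) * (k + 1) := by rwa [div_lt_iff₀ (by positivity)] at hk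
    nlinarith
  obtain ⟨a, ha, hind⟩ := generic (Y := Fin R → Fin (N + 2) → (Fin m → ℝ))
    (E := (Fin m → ℝ) × (Fin m → ℝ))
    (C := {x : (Fin (N + 1) × Fin R × Fin (N + 1) × Fin R × Finset (Fin R)) //
      (x.1 : ℕ) + 1 < (x.2.2.1 : ℕ) ∧ x.2.2.2.2.card ≤ m + 1})
    (κ := fun c => c.1.2.2.2.2 ⊕ Bool)
    (fun c => lamTwo c.1.1 c.1.2.1 c.1.2.2.1 c.1.2.2.2.1 c.1.2.2.2.2)
    (fun c => lamTwo_witness hm _ _ _ _ c.2.1 (by omega) _ c.2.2)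
    a₀ (r := ε / 3) (by positivity)
  set H' := stagMap N φ (extN a) with hH'
  have hclose : ∀ p, ‖H' p - H p‖ < ε := fun p => by
    have := ha₀ a ha p
    rw [hH']; linarith
  -- two zeros of `H'` on the same fibre have close times
  have key : ∀ z (t t' : unitInterval), H' (z, t) = 0 → H' (z, t') = 0 →
      (N : ℝ) * t' ≤ N * t + 2 := by
    intro z t t' ht ht'
    have hR : 0 < R := by
      rcases Nat.eq_zero_or_pos R with h | h
      · subst h
        have := g1 z; simp at this
      · exact h
    obtain ⟨q, ρ, s, hq, hq1, hq2, hst⟩ := stagMap_eq (E := Fin m → ℝ) (Z := Z) hR N t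
    obtain ⟨q', ρ', s', hq', hq1', hq2', hst'⟩ := stagMap_eq (E := Fin m → ℝ) (Z := Z) hR N t'
    rw [hH', hst] at ht
    rw [hH', hst'] at ht'
    by_contra hc
    push Not at hc
    have hqq : q + 1 < q' := by
      have : (q : ℝ) + 1 < q' := by linarith
      exact_mod_cast this
    let σ : Finset (Fin R) := Finset.univ.filter fun i => φ i z ≠ 0
    have hσ : σ.card ≤ m + 1 := g2 z σ (by simp [σ])
    have hl := hind ⟨(⟨q, by omega⟩, ρ, ⟨q', by omega⟩, ρ', σ), hqq, hσ⟩
    rw [Fintype.linearIndependent_iff] at hl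
    have hsum : ∀ f : Fin R → (Fin m → ℝ), ∑ i : σ, φ i z • f i = ∑ i, φ i z • f i := fun f => by
      rw [Finset.sum_coe_sort σ (fun i => φ i z • f i)]
      refine Finset.sum_subset (Finset.subset_univ _) fun i _ hi => ?_
      simp only [σ, Finset.mem_filter, Finset.mem_univ, true_and, not_not] at hi
      simp [hi]
    have h5 := hl (fun o => match o with
      | Sum.inl i => φ i z
      | Sum.inr true => φ ρ z * s
      | Sum.inr false => φ ρ' z * s') (by
        rw [Fintype.sum_sum_type, Fintype.sum_bool]
        change ∑ i : σ, φ i z • (extN a i (q + stagOff ρ i), extN a i (q' + stagOff ρ' i)) +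
          ((φ ρ z * s) • (extN a ρ (q + 1) - extN a ρ q, (0 : Fin m → ℝ)) +
          (φ ρ' z * s') • ((0 : Fin m → ℝ), extN a ρ' (q' + 1) - extN a ρ' q')) = 0
        refine Prod.ext ?_ ?_
        · simp only [Prod.fst_add, Prod.fst_sum, Prod.smul_fst, smul_zero, add_zero, Prod.fst_zero]
          rw [hsum (fun i => extN a i (q + stagOff ρ i))]
          exact ht
        · simp only [Prod.snd_add, Prod.snd_sum, Prod.smul_snd, smul_zero, zero_add, Prod.snd_zero]
          rw [hsum (fun i => extN a i (q' + stagOff ρ' i))]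
          exact ht')
    have h6 : ∀ i, φ i z = 0 := fun i => by
      by_contra hi
      exact hi (h5 (Sum.inl ⟨i, by simpa [σ] using hi⟩))
    have := g1 z
    simp [h6] at this
  have hzero : ∀ p, H' p = 0 → ε ≤ |η p| := fun p hp => by
    refine hgap' p ?_
    have := hclose p
    rwa [hp, zero_sub, norm_neg] at this
  let S : Set Z := Prod.fst '' {p : Z × unitInterval | H' p = 0 ∧ 0 ≤ η p}
  let T : Set Z := Prod.fst '' {p : Z × unitInterval | H' p = 0 ∧ η p ≤ 0}
  have hS : IsClosed S := by
    have e1 : IsClosed {p : Z × unitInterval | H' p = 0} := isClosed_eq (by fun_prop) (by fun_prop)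
    have e2 : IsClosed {p : Z × unitInterval | 0 ≤ η p} := isClosed_le (by fun_prop) (by fun_prop)
    exact ((e1.inter e2).isCompact.image continuous_fst).isClosed
  have hT : IsClosed T := by
    have e1 : IsClosed {p : Z × unitInterval | H' p = 0} := isClosed_eq (by fun_prop) (by fun_prop)
    have e2 : IsClosed {p : Z × unitInterval | η p ≤ 0} := isClosed_le (by fun_prop) (by fun_prop)
    exact ((e1.inter e2).isCompact.image continuous_fst).isClosed
  have hST : Disjoint S T := by
    rw [Set.disjoint_left]
    rintro _ ⟨⟨z, t⟩, ⟨e1, e2⟩, rfl⟩ ⟨⟨z', t'⟩, ⟨e3, e4⟩, hz⟩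
    have hz : z' = z := hz
    subst hz
    have e5 := hzero _ e1
    have e6 := hzero _ e3
    rw [abs_of_nonneg e2] at e5
    rw [abs_of_nonpos e4] at e6
    have e7 := key _ _ _ e1 e3
    have e8 := key _ _ _ e3 e1
    have e9 : dist t t' < δ := by
      rw [Subtype.dist_eq, Real.dist_eq, abs_lt]
      constructor
      · by_contra hc
        push Not at hc
        nlinarith
      · by_contra hc
        push Not at hc
        nlinarith
    have e10 := hδ' z' t t' e9
    rw [Real.dist_eq] at e10
    have := le_abs_self (η (z', t) - η (z', t'))
    linarith
  obtain ⟨u, hu0, hu1, hu⟩ := exists_continuous_zero_one_of_isClosed hS hT hST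
  refine ⟨⟨fun z => H' (z, ⟨u z, hu z⟩), by fun_prop⟩, fun z hz => ?_, fun z hz _ => ?_⟩
  · simp only [ContinuousMap.coe_mk] at hz
    rcases le_total 0 (η (z, ⟨u z, hu z⟩)) with hs | hs
    · have e1 : u z = 0 := hu0 ⟨_, ⟨hz, hs⟩, rfl⟩
      have e2 : (⟨u z, hu z⟩ : unitInterval) = 0 := Subtype.ext e1
      rw [e2] at hs
      exact absurd (h3 z) (not_lt.2 hs)
    · have e1 : u z = 1 := hu1 ⟨_, ⟨hz, hs⟩, rfl⟩
      have e2 : (⟨u z, hu z⟩ : unitInterval) = 1 := Subtype.ext e1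
      rw [e2] at hs
      exact absurd (h4 z) (not_lt.2 hs)
  · simp only [ContinuousMap.coe_mk]
    have := hclose (z, ⟨u z, hu z⟩)
    rw [h2 _ _ hz] at this
    linarith

lemma rem_of_prod_I {Z : Type*} [TopologicalSpace Z] [CompactSpace Z] [T2Space Z] {m : ℕ}
    (h : Rem (Z × unitInterval) (Fin (m + 1) → ℝ)) : Rem Z (Fin m → ℝ) := by
  have h' : Rem (Z × unitInterval) ((Fin m → ℝ) × ℝ) := h.congr_finrank (by simp)
  rcases Nat.lt_or_ge m 3 with hm | hm
  · interval_cases m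
    · exact lower_zero h'
    · have h'' : Rem (Z × unitInterval) (ℝ × ℝ) := h.congr_finrank (by simp)
      exact (lower_rclike (𝕜 := ℝ) h'').congr_finrank (by simp)
    · have h'' : Rem (Z × unitInterval) (ℂ × ℝ) := h.congr_finrank (by simp)
      exact (lower_rclike (𝕜 := ℂ) h'').congr_finrank (by simp)
  · exact lower_big hm h'

end LowerBig



section Assembly

lemma isEmpty_of_rem_zero {Z : Type*} [TopologicalSpace Z] (h : Rem Z (Fin 0 → ℝ)) : IsEmpty Z := by
  obtain ⟨g, hg, -⟩ := h 0
  exact ⟨fun z => hg z (Subsingleton.elim _ _)⟩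

lemma rem_prod_I_iff {Z : Type*} [TopologicalSpace Z] [CompactSpace Z] [T2Space Z] [Nonempty Z]
    {k : ℕ} : Rem (Z × unitInterval) (Fin (k + 1) → ℝ) ↔
      ∃ j, k = j + 1 ∧ Rem Z (Fin (j + 1) → ℝ) := by
  constructor
  · intro h
    have h1 := rem_of_prod_I h
    rcases k with _ | k
    · exact absurd (isEmpty_of_rem_zero h1) (by simp)
    · exact ⟨k, rfl, h1⟩
  · rintro ⟨j, rfl, h⟩
    exact rem_prod_I (covDimLE_iff.2 h)

/-- Splitting off one coordinate of a cube. -/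
noncomputable def cubeSplit (n : ℕ) (Z : Type*) [TopologicalSpace Z] :
    (Fin (n + 1) → unitInterval) × Z ≃ₜ (Fin n → unitInterval) × (Z × unitInterval) where
  toFun p := (fun i => p.1 i.succ, p.2, p.1 0)
  invFun q := (Fin.cons q.2.2 q.1, q.2.1)
  left_inv p := by
    refine Prod.ext (funext fun i => ?_) rfl
    refine Fin.cases ?_ (fun i => ?_) i <;> simp
  right_inv q := by simp
  continuous_toFun := by fun_prop
  continuous_invFun := by
    refine Continuous.prodMk (continuous_pi fun i => ?_) (by fun_prop)
    refine Fin.cases ?_ (fun i => ?_) i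
    · simp only [Fin.cons_zero]; fun_prop
    · simp only [Fin.cons_succ]; fun_prop

lemma rem_cube_iff (n : ℕ) : ∀ {Z : Type u} [TopologicalSpace Z] [CompactSpace Z] [T2Space Z]
    [Nonempty Z] {k : ℕ}, Rem ((Fin n → unitInterval) × Z) (Fin (k + 1) → ℝ) ↔
      ∃ j, k = n + j ∧ Rem Z (Fin (j + 1) → ℝ) := by
  induction n with
  | zero =>
    intro Z _ _ _ _ k
    have e : (Fin 0 → unitInterval) × Z ≃ₜ Z := Homeomorph.uniqueProd _ _
    constructor
    · intro h
      exact ⟨k, by simp, h.of_homeo e⟩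
    · rintro ⟨j, hj, h⟩
      obtain rfl : k = j := by omega
      exact h.of_homeo e.symm
  | succ n ih =>
    intro Z _ _ _ _ k
    have h1 : Rem ((Fin (n + 1) → unitInterval) × Z) (Fin (k + 1) → ℝ) ↔
        Rem ((Fin n → unitInterval) × (Z × unitInterval)) (Fin (k + 1) → ℝ) :=
      ⟨fun h => h.of_homeo (cubeSplit n Z), fun h => h.of_homeo (cubeSplit n Z).symm⟩
    rw [h1, ih]
    constructor
    · rintro ⟨j, rfl, h⟩
      obtain ⟨i, rfl, hi⟩ := rem_prod_I_iff.1 h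
      exact ⟨i, by omega, hi⟩
    · rintro ⟨j, rfl, h⟩
      exact ⟨j + 1, by omega, rem_prod_I_iff.2 ⟨j, rfl, h⟩⟩

/-- Cubes in manifolds. -/
lemma exists_cube {M : Type*} [TopologicalSpace M] {n : ℕ} (h : IsTopManifold M n) (x : M) :
    ∃ κ : (Fin n → unitInterval) → M, Continuous κ ∧ Function.Injective κ ∧ range κ ∈ 𝓝 x := by
  obtain ⟨U, hU, hx, ⟨e⟩⟩ := h x
  set p := e ⟨x, hx⟩ with hp
  let c : (Fin n → unitInterval) → EuclideanSpace ℝ (Fin n) :=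
    fun t => WithLp.toLp 2 (fun i => p i + 2 * (t i : ℝ) - 1)
  have hc : Continuous c := by
    refine (PiLp.continuous_toLp 2 _).comp ?_
    fun_prop
  refine ⟨fun t => (e.symm (c t) : M), by fun_prop, ?_, ?_⟩
  · intro s t hst
    have h1 : c s = c t := e.symm.injective (Subtype.val_injective hst)
    funext i
    have h2 : c s i = c t i := by rw [h1]
    simp only [c] at h2
    exact Subtype.ext (by linarith)
  · have ho : IsOpen {y : U | ∀ i, |e y i - p i| < 1} := by
      simp only [Set.ofPred_forall]
      exact isOpen_iInter_of_finite fun i => isOpen_lt (by fun_prop) continuous_const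
    refine Filter.mem_of_superset ((hU.isOpenMap_subtype_val _ ho).mem_nhds
      (x := x) ⟨⟨x, hx⟩, fun i => by simp [hp], rfl⟩) ?_
    rintro _ ⟨y, hy, rfl⟩
    refine ⟨fun i => ⟨(e y i - p i + 1) / 2, ?_⟩, ?_⟩
    · have := abs_lt.1 (hy i)
      exact ⟨by linarith, by linarith⟩
    · have : c (fun i => ⟨(e y i - p i + 1) / 2, by
          have := abs_lt.1 (hy i)
          exact ⟨by linarith, by linarith⟩⟩) = e y := by
        ext i
        simp only [c]
        ring
      simp only [this]
      simp

lemma exists_cube_stoneCech {M : Type*} [TopologicalSpace M] [T35Space M] {n : ℕ}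
    (h : IsTopManifold M n) (x : M) :
    ∃ κ : (Fin n → unitInterval) → StoneCech M, Continuous κ ∧ Function.Injective κ ∧
      range κ ∈ 𝓝 (stoneCechUnit x) ∧ range κ ⊆ range (stoneCechUnit : M → StoneCech M) := by
  obtain ⟨κ, h1, h2, h3⟩ := exists_cube h x
  have hemb : IsEmbedding (stoneCechUnit : M → StoneCech M) := isEmbedding_stoneCechUnit
  refine ⟨fun t => stoneCechUnit (κ t), continuous_stoneCechUnit.comp h1,
    hemb.injective.comp h2, ?_, ?_⟩
  · rw [hemb.isInducing.nhds_eq_comap, Filter.mem_comap] at h3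
    obtain ⟨T, hT, hTs⟩ := h3
    obtain ⟨W, hWT, hW, hxW⟩ := mem_nhds_iff.1 hT
    refine Filter.mem_of_superset (hW.mem_nhds hxW) ?_
    have hcl : IsClosed (range fun t => (stoneCechUnit (κ t) : StoneCech M)) :=
      (isCompact_range (continuous_stoneCechUnit.comp h1)).isClosed
    refine ((denseRange_stoneCechUnit (α := M)).open_subset_closure_inter hW).trans
      (closure_minimal ?_ hcl)
    rintro _ ⟨hy, ⟨y, rfl⟩⟩
    obtain ⟨t, ht⟩ := hTs (show y ∈ stoneCechUnit ⁻¹' T from hWT hy)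
    exact ⟨t, by simp [ht]⟩
  · rintro _ ⟨t, rfl⟩
    exact ⟨κ t, rfl⟩

lemma isClosed_remainder {M : Type*} [TopologicalSpace M] [T35Space M] {n : ℕ}
    (h : IsTopManifold M n) : IsClosed (StoneCechRemainder M) := by
  unfold StoneCechRemainder
  rw [isClosed_compl_iff, isOpen_iff_mem_nhds]
  rintro _ ⟨x, rfl⟩
  obtain ⟨κ, -, -, h1, h2⟩ := exists_cube_stoneCech h x
  exact Filter.mem_of_superset h1 h2

/-- The key equivalence. -/
lemma rem_prod_iff {M₁ M₂ : Type u} [TopologicalSpace M₁] [TopologicalSpace M₂]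
    [T35Space M₁] [T35Space M₂] [Nonempty M₁] [Nonempty M₂] {n₁ n₂ : ℕ}
    (hM₁ : IsTopManifold M₁ n₁) (hM₂ : IsTopManifold M₂ n₂) {k : ℕ} :
    Rem (StoneCech M₁ × StoneCech M₂) (Fin k → ℝ) ↔
      Rem ((Fin n₁ → unitInterval) × StoneCech M₂) (Fin k → ℝ) ∧
      Rem ((Fin n₂ → unitInterval) × StoneCech M₁) (Fin k → ℝ) ∧
      Rem (StoneCechRemainder M₁ × StoneCechRemainder M₂) (Fin k → ℝ) := by
  have hF1 := isClosed_remainder hM₁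
  have hF2 := isClosed_remainder hM₂
  have hF : IsClosedEmbedding (Prod.map Subtype.val Subtype.val :
      StoneCechRemainder M₁ × StoneCechRemainder M₂ → StoneCech M₁ × StoneCech M₂) :=
    hF1.isClosedEmbedding_subtypeVal.prodMap hF2.isClosedEmbedding_subtypeVal
  have hA : ∀ κ : (Fin n₁ → unitInterval) → StoneCech M₁, Continuous κ → Function.Injective κ →
      IsClosedEmbedding (fun p : (Fin n₁ → unitInterval) × StoneCech M₂ => (κ p.1, p.2)) :=
    fun κ hc hi => Continuous.isClosedEmbedding (by fun_prop) (by
      rintro ⟨a, b⟩ ⟨c, d⟩ h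
      simp only [Prod.mk.injEq] at h
      rw [hi h.1, h.2])
  have hB : ∀ κ : (Fin n₂ → unitInterval) → StoneCech M₂, Continuous κ → Function.Injective κ →
      IsClosedEmbedding (fun p : (Fin n₂ → unitInterval) × StoneCech M₁ => (p.2, κ p.1)) :=
    fun κ hc hi => Continuous.isClosedEmbedding (by fun_prop) (by
      rintro ⟨a, b⟩ ⟨c, d⟩ h
      simp only [Prod.mk.injEq] at h
      rw [hi h.2, h.1])
  constructor
  · intro h
    obtain ⟨x₁⟩ := ‹Nonempty M₁›
    obtain ⟨x₂⟩ := ‹Nonempty M₂›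
    obtain ⟨κ₁, hc₁, hi₁, -⟩ := exists_cube_stoneCech hM₁ x₁
    obtain ⟨κ₂, hc₂, hi₂, -⟩ := exists_cube_stoneCech hM₂ x₂
    exact ⟨h.of_isClosedEmbedding (hA κ₁ hc₁ hi₁), h.of_isClosedEmbedding (hB κ₂ hc₂ hi₂),
      h.of_isClosedEmbedding hF⟩
  · rintro ⟨h1, h2, h3⟩
    refine rem_of_dowker hF.isClosed_range (remOn_range hF h3) fun Y hY hYF => ?_
    have key : ∀ y ∈ Y, ∃ C : Set (StoneCech M₁ × StoneCech M₂), C ∈ 𝓝 y ∧ IsCompact C ∧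
        RemOn C (Fin k → ℝ) := by
      rintro ⟨a, b⟩ hy
      by_cases ha : a ∈ range (stoneCechUnit : M₁ → StoneCech M₁)
      · obtain ⟨x, rfl⟩ := ha
        obtain ⟨κ, hc, hi, hn, -⟩ := exists_cube_stoneCech hM₁ x
        refine ⟨_, ?_, isCompact_range (hA κ hc hi).continuous, remOn_range (hA κ hc hi) h1⟩
        refine Filter.mem_of_superset (prod_mem_nhds hn Filter.univ_mem) ?_
        rintro ⟨_, z⟩ ⟨⟨t, rfl⟩, -⟩
        exact ⟨(t, z), rfl⟩
      by_cases hb : b ∈ range (stoneCechUnit : M₂ → StoneCech M₂)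
      · obtain ⟨x, rfl⟩ := hb
        obtain ⟨κ, hc, hi, hn, -⟩ := exists_cube_stoneCech hM₂ x
        refine ⟨_, ?_, isCompact_range (hB κ hc hi).continuous, remOn_range (hB κ hc hi) h2⟩
        refine Filter.mem_of_superset (prod_mem_nhds Filter.univ_mem hn) ?_
        rintro ⟨z, _⟩ ⟨-, ⟨t, rfl⟩⟩
        exact ⟨(t, z), rfl⟩
      · exact absurd ⟨(⟨a, ha⟩, ⟨b, hb⟩), rfl⟩ (Set.disjoint_left.1 hYF hy)
    choose! C hC1 hC2 hC3 using key
    obtain ⟨t, ht, hYt⟩ := hY.isCompact.elim_nhds_subcover C hC1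
    exact (RemOn.biUnion t C (fun i hi => hC2 i (ht i hi)) fun i hi => hC3 i (ht i hi)).mono hYt

lemma CovDimLE.mono {X : Type*} [TopologicalSpace X] {m n : ℕ} (h : CovDimLE X m) (hmn : m ≤ n) :
    CovDimLE X n := by
  intro 𝒰 h1 h2
  obtain ⟨𝒱, a, b, c, d⟩ := h 𝒰 h1 h2
  exact ⟨𝒱, a, b, c, fun 𝒲 hw hc => d 𝒲 hw (by omega)⟩

lemma covDim_le_iff {X : Type*} [TopologicalSpace X] {k : ℕ} :
    covDim X ≤ (k : ℕ∞) ↔ Rem X (Fin (k + 1) → ℝ) := by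
  rw [← covDimLE_iff]
  constructor
  · intro h
    unfold covDim at h
    have hne : ((fun n : ℕ => (n : ℕ∞)) '' {n : ℕ | CovDimLE X n}).Nonempty := by
      by_contra hne
      rw [Set.not_nonempty_iff_eq_empty] at hne
      rw [hne, sInf_empty] at h
      exact absurd h (by simp)
    obtain ⟨n, hn, hn'⟩ := csInf_mem hne
    have h' : (n : ℕ∞) ≤ k := by
      rw [← hn'] at h
      exact h
    exact CovDimLE.mono hn (by exact_mod_cast h')
  · intro h
    exact sInf_le ⟨k, h, rfl⟩

lemma enat_eq_of_forall_le_iff {a b : ℕ∞} (h : ∀ k : ℕ, a ≤ k ↔ b ≤ k) : a = b := by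
  refine le_antisymm ?_ ?_
  · induction b using ENat.recTopCoe with
    | top => simp
    | coe b => exact (h b).2 le_rfl
  · induction a using ENat.recTopCoe with
    | top => simp
    | coe a => exact (h a).1 le_rfl

lemma cube_le_iff {M : Type u} [TopologicalSpace M] [Nonempty M] {m n k : ℕ}
    (hd : covDim M = (m : ℕ∞)) :
    Rem ((Fin n → unitInterval) × StoneCech M) (Fin (k + 1) → ℝ) ↔ n + m ≤ k := by
  have : Nonempty (StoneCech M) := ‹Nonempty M›.map stoneCechUnit
  have hj : ∀ j : ℕ, Rem (StoneCech M) (Fin (j + 1) → ℝ) ↔ m ≤ j := fun j => by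
    rw [← rem_stoneCech_iff, ← covDim_le_iff, hd]
    exact Nat.cast_le
  rw [rem_cube_iff]
  constructor
  · rintro ⟨j, rfl, h⟩
    have := (hj j).1 h
    omega
  · intro h
    exact ⟨k - n, by omega, (hj _).2 (by omega)⟩

end Assembly
/-- For countably compact normal `nᵢ`-manifolds `Mᵢ` with `dim Mᵢ = mᵢ`,
`dim (M₁ × M₂) = max {n₁ + m₂, n₂ + m₁, dim (M₁* × M₂*)}` where `Mᵢ*` is the
Stone–Čech remainder. -/
theorem covDim_prod_manifolds (M₁ : Type u) (M₂ : Type u)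
    [TopologicalSpace M₁] [TopologicalSpace M₂] [NormalSpace M₁] [NormalSpace M₂]
    [T35Space M₁] [T35Space M₂] [Nonempty M₁] [Nonempty M₂]
    (n₁ n₂ m₁ m₂ : ℕ)
    (hM₁ : IsTopManifold M₁ n₁) (hM₂ : IsTopManifold M₂ n₂)
    (h₁ : CountablyCompact M₁) (h₂ : CountablyCompact M₂)
    (hd₁ : covDim M₁ = (m₁ : ℕ∞)) (hd₂ : covDim M₂ = (m₂ : ℕ∞)) :
    covDim (M₁ × M₂) =
      max (max ((n₁ + m₂ : ℕ) : ℕ∞) ((n₂ + m₁ : ℕ) : ℕ∞))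
        (covDim (↥(StoneCechRemainder M₁) × ↥(StoneCechRemainder M₂))) := by
  refine enat_eq_of_forall_le_iff fun k => ?_
  have := hM₁.firstCountable
  rw [covDim_le_iff, rem_prod_stoneCech_iff h₁ h₂, rem_prod_iff hM₁ hM₂, cube_le_iff hd₂,
    cube_le_iff hd₁, max_le_iff, max_le_iff, covDim_le_iff, Nat.cast_le, Nat.cast_le, and_assoc]
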